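/- arXiv:2601.03984 — 4 statements merged into one kernel-verified Lean document; each statement's English description precedes it below -/
import Mathlib

section
/- Let K be a cubic field with resolvent discriminant d, and let p ≥ 5 be a prime that is totally ramified in K. Then the Legendre symbol (d/p) equals 1 if and only if p ≡ 1 (mod 3). -/
open NumberField IntermediateField Polynomial

noncomputable section

/-- The set of cubic subfields of `ℂ` whose discriminant satisfies `P`. -/
def CubicSet (P : ℤ → Prop) : Set (IntermediateField ℚ ℂ) :=
  {F | ∃ h : Module.finrank ℚ F = 3,
    letI : FiniteDimensional ℚ F := FiniteDimensional.of_finrank_eq_succ h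
    letI : NumberField F := ⟨⟩
    P (NumberField.discr F)}

/-- Cubic subfields of `ℂ`, up to `ℚ`-algebra isomorphism.  Since every cubic field
embeds into `ℂ`, these classes are exactly the isomorphism classes of cubic fields. -/
def cubicSetoid (P : ℤ → Prop) : Setoid (CubicSet P) where
  r F G := Nonempty (F.1 ≃ₐ[ℚ] G.1)
  iseqv := ⟨fun _ => ⟨AlgEquiv.refl⟩, fun ⟨e⟩ => ⟨e.symm⟩, fun ⟨e⟩ ⟨f⟩ => ⟨e.trans f⟩⟩

/-- The number of isomorphism classes of cubic fields whose discriminant satisfies `P`. -/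
def cubicCount (P : ℤ → Prop) : ℕ := Nat.card (Quotient (cubicSetoid P))

/-- A prime `p` is totally ramified in `K` if `pO_K = 𝔭³` for a prime ideal `𝔭`. -/
def TotallyRamified (p : ℕ) (K : Type*) [Field K] [NumberField K] : Prop :=
  ∃ 𝔭 : Ideal (𝓞 K), 𝔭.IsPrime ∧ Ideal.span {(p : 𝓞 K)} = 𝔭 ^ 3

lemma isIntegral_of_sq (Δ : ℤ) (x : ℂ) (hx : x ^ 2 = (Δ : ℂ)) : IsIntegral ℚ x := by
  refine ⟨X ^ 2 - C (Δ : ℚ), monic_X_pow_sub_C _ two_ne_zero, ?_⟩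
  simp only [eval₂_sub, eval₂_X_pow, eval₂_C, hx]
  simp [map_intCast]

/-- `d` is the resolvent discriminant of a cubic field of discriminant `Δ`:
`d = 1` if `Δ` is a perfect square, and otherwise `d` is the discriminant of the
quadratic field `ℚ(√Δ)` (which does not depend on the chosen square root `x` of `Δ`). -/
def IsResolventDiscrOf (Δ d : ℤ) : Prop :=
  (IsSquare Δ ∧ d = 1) ∨
  (¬ IsSquare Δ ∧ ∃ (x : ℂ) (hx : x ^ 2 = (Δ : ℂ)),
    letI : FiniteDimensional ℚ ℚ⟮x⟯ := adjoin.finiteDimensional (isIntegral_of_sq Δ x hx)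
    letI : NumberField ℚ⟮x⟯ := ⟨⟩
    d = NumberField.discr ℚ⟮x⟯)

/-- The discriminant of a family of integers is a square times the field discriminant. -/
lemma exists_discr_eq_sq_mul (F : Type*) [Field F] [NumberField F] (n : ℕ)
    (hn : Module.finrank ℚ F = n) (v : Fin n → 𝓞 F) :
    ∃ s : ℤ, Algebra.discr ℤ v = s ^ 2 * NumberField.discr F := by
  have hn' : Module.finrank ℤ (𝓞 F) = n := by rw [RingOfIntegers.rank, hn]
  let b : Module.Basis (Fin n) ℤ (𝓞 F) := Module.finBasisOfFinrankEq ℤ (𝓞 F) hn'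
  refine ⟨(b.toMatrix v).det, ?_⟩
  rw [← NumberField.discr_eq_discr F b, ← Algebra.discr_of_matrix_vecMul]
  congr 1
  ext1 i
  conv_lhs => rw [← b.sum_toMatrix_smul_self v i]
  simp [Matrix.vecMul, dotProduct, mul_comm, Algebra.smul_def]

lemma legendre_neg_three (p : ℕ) [Fact p.Prime] (hp5 : 5 ≤ p) :
    IsSquare (-3 : ZMod p) ↔ p % 3 = 1 := by
  haveI : Fact (Nat.Prime 3) := ⟨Nat.prime_three⟩
  have hp : p.Prime := Fact.out
  have h2 : p ≠ 2 := by omega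
  have hodd : p % 2 = 1 := (hp.eq_two_or_odd).resolve_left h2
  have h3 : ¬ 3 ∣ p := fun h => by
    have := (Nat.prime_dvd_prime_iff_eq Nat.prime_three hp).1 h
    omega
  have h3' : ((-3 : ℤ) : ZMod p) ≠ 0 := by
    rw [Ne, ZMod.intCast_zmod_eq_zero_iff_dvd]
    intro h
    have : (p : ℤ) ∣ 3 := by simpa using h
    have := Int.le_of_dvd (by norm_num) this
    omega
  have key : legendreSym p (-3) = legendreSym 3 p := by
    have e : (-3 : ℤ) = (-1) * ((3 : ℕ) : ℤ) := by norm_num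
    rw [e, legendreSym.mul, legendreSym.at_neg_one h2, ZMod.χ₄_eq_neg_one_pow hodd,
      legendreSym.quadratic_reciprocity' (p := p) (q := 3) h2 (by norm_num)]
    norm_num
  have h4 : (((p : ℕ) : ℤ) : ZMod 3) ≠ 0 := by
    rw [Ne, ZMod.intCast_zmod_eq_zero_iff_dvd]
    exact_mod_cast h3
  have h5 := legendreSym.eq_one_iff p h3'
  have h6 := legendreSym.eq_one_iff 3 h4
  rw [key, h6] at h5
  push_cast at h5
  rw [← h5, ← ZMod.natCast_mod]
  have : p % 3 = 1 ∨ p % 3 = 2 := by omega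
  rcases this with h | h <;> rw [h] <;> clear h h6 h5 h4 key h3' h3 hodd h2 hp hp5 <;> decide +revert

/-- If `x ^ 3` is divisible by `p` then `p` divides the trace of `x`. -/
lemma dvd_trace (F : Type*) [Field F] [NumberField F] (p : ℕ) [Fact p.Prime] (x : 𝓞 F)
    (hx : (p : 𝓞 F) ∣ x ^ 3) : (p : ℤ) ∣ Algebra.trace ℤ (𝓞 F) x := by
  obtain ⟨y, hy⟩ := hx
  let b := RingOfIntegers.basis F
  rw [← ZMod.intCast_zmod_eq_zero_iff_dvd, Algebra.trace_eq_matrix_trace b]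
  let f : Matrix (Module.Free.ChooseBasisIndex ℤ (𝓞 F)) (Module.Free.ChooseBasisIndex ℤ (𝓞 F)) ℤ →+*
      Matrix (Module.Free.ChooseBasisIndex ℤ (𝓞 F)) (Module.Free.ChooseBasisIndex ℤ (𝓞 F))
        (ZMod p) := (Int.castRingHom (ZMod p)).mapMatrix
  have h1 : IsNilpotent (f (Algebra.leftMulMatrix b x)) := by
    refine ⟨3, ?_⟩
    rw [← map_pow, ← map_pow, hy, map_mul, map_mul, map_natCast, map_natCast]
    have : ((p : ℕ) : Matrix (Module.Free.ChooseBasisIndex ℤ (𝓞 F))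
      (Module.Free.ChooseBasisIndex ℤ (𝓞 F)) (ZMod p)) = 0 := by
      ext i j
      simp [Matrix.natCast_apply]
    rw [this, zero_mul]
  have h2 := (Matrix.isNilpotent_trace_of_isNilpotent h1).eq_zero
  rw [← h2]
  simp [f, Matrix.trace, Matrix.diag]

lemma quad_discr (F : Type*) [Field F] [NumberField F] (hF : Module.finrank ℚ F = 2)
    (z : F) (hz : IsIntegral ℤ z) (u : ℤ) (hzu : z ^ 2 = (u : F))
    (htz : Algebra.trace ℚ F z = 0) :
    ∃ s : ℤ, 4 * u = s ^ 2 * NumberField.discr F := by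
  obtain ⟨y, rfl⟩ : ∃ y : 𝓞 F, (y : F) = z := ⟨⟨z, hz⟩, rfl⟩
  have hy : y ^ 2 = (u : 𝓞 F) := by
    apply RingOfIntegers.ext
    simpa using hzu
  have ht : Algebra.trace ℚ F (y : F) = 0 := htz
  obtain ⟨s, hs⟩ := exists_discr_eq_sq_mul F 2 hF ![1, y]
  refine ⟨s, ?_⟩
  have hF' : Module.finrank ℤ (𝓞 F) = 2 := by rw [RingOfIntegers.rank, hF]
  have ht' : Algebra.trace ℤ (𝓞 F) y = 0 := by
    have := Algebra.coe_trace_int (K := F) y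
    rw [ht] at this
    exact_mod_cast this
  have hc : ∀ k : ℤ, Algebra.trace ℤ (𝓞 F) (k : 𝓞 F) = 2 * k := fun k => by
    have := Algebra.trace_algebraMap (S := 𝓞 F) (k : ℤ)
    rw [hF'] at this
    simpa using this
  have hc1 : Algebra.trace ℤ (𝓞 F) (1 : 𝓞 F) = 2 := by simpa using hc 1
  rw [← hs, Algebra.discr_def, Matrix.det_fin_two]
  simp [Algebra.traceMatrix_apply, Algebra.traceForm_apply, ht', ← pow_two, hy, hc, hc1]
  ring

lemma cubic_discr (K : Type*) [Field K] [NumberField K] (hK : Module.finrank ℚ K = 3)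
    (p : ℕ) [Fact p.Prime] (hram : TotallyRamified p K) :
    ∃ s u n k : ℤ, s ^ 2 * NumberField.discr K = p ^ 2 * u ∧ u = -27 * n ^ 2 + p * k ∧
      ¬ (p : ℤ) ∣ n := by
  have hp : p.Prime := Fact.out
  obtain ⟨P, hP, hPp⟩ := hram
  have hK' : Module.finrank ℤ (𝓞 K) = 3 := by rw [RingOfIntegers.rank, hK]
  have hmem : ∀ x, x ∈ P ^ 3 ↔ (p : 𝓞 K) ∣ x := fun x => by
    rw [← hPp, Ideal.mem_span_singleton]
  have hp0 : (p : 𝓞 K) ≠ 0 := by exact_mod_cast hp.ne_zero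
  have hP0 : P ≠ ⊥ := by
    rintro rfl
    have : (p : 𝓞 K) ∈ (⊥ : Ideal (𝓞 K)) ^ 3 := (hmem _).2 dvd_rfl
    rw [← Ideal.zero_eq_bot, zero_pow (by norm_num)] at this
    exact hp0 (by simpa using this)
  have hnorm : Ideal.absNorm P = p := by
    have := congrArg Ideal.absNorm hPp
    rw [Ideal.absNorm_span_natCast, hK', map_pow] at this
    exact (Nat.pow_left_injective (by norm_num : 3 ≠ 0) this).symm
  have hpP : (p : 𝓞 K) ∈ P := by
    have := Ideal.absNorm_mem P
    rwa [hnorm] at this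
  -- the residue field is the prime field
  have hres : ∀ x : 𝓞 K, ∃ n : ℤ, x - n ∈ P := by
    intro x
    have hcard : Nat.card (𝓞 K ⧸ P) = p := by
      rw [← hnorm, Ideal.absNorm_apply, Submodule.cardQuot_apply]
    haveI : Finite (𝓞 K ⧸ P) := Nat.finite_of_card_ne_zero (by rw [hcard]; exact hp.ne_zero)
    haveI := Fintype.ofFinite (𝓞 K ⧸ P)
    rw [Nat.card_eq_fintype_card] at hcard
    let e := ZMod.ringEquivOfPrime (𝓞 K ⧸ P) hp hcard
    obtain ⟨z, hz⟩ := e.surjective (Ideal.Quotient.mk P x)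
    obtain ⟨n, rfl⟩ := ZMod.intCast_surjective z
    refine ⟨n, ?_⟩
    rw [← Ideal.Quotient.eq_zero_iff_mem, map_sub, ← hz, map_intCast, map_intCast, sub_self]
  have htr : ∀ x ∈ P, (p : ℤ) ∣ Algebra.trace ℤ (𝓞 K) x := fun x hx =>
    dvd_trace K p x ((hmem _).1 (Ideal.pow_mem_pow hx 3))
  obtain ⟨a, haP, haP2⟩ := Ideal.exists_mem_pow_notMem_pow_succ P hP0 hP.ne_top 1
  rw [pow_one] at haP
  obtain ⟨b, hb⟩ := (hmem _).1 (Ideal.pow_mem_pow haP 3)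
  have hbP : b ∉ P := by
    intro hbP
    have h4 : a ^ 3 ∈ P ^ 4 := by
      rw [hb, pow_succ P 3]
      exact Ideal.mul_mem_mul ((hmem _).2 dvd_rfl) hbP
    have hPp' := Ideal.prime_of_isPrime hP0 hP
    rw [← Ideal.span_singleton_le_iff_mem, ← Ideal.dvd_iff_le] at haP haP2 h4
    obtain ⟨I, hI⟩ := haP
    rw [← Ideal.span_singleton_pow, hI, mul_pow, pow_succ P 3] at h4
    have h5 := (mul_dvd_mul_iff_left (pow_ne_zero 3 hPp'.ne_zero)).1 h4
    have h6 := hPp'.dvd_of_dvd_pow h5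
    apply haP2
    rw [hI, pow_two]
    exact mul_dvd_mul_left P h6
  obtain ⟨n, hn⟩ := hres b
  have hpn : ¬ (p : ℤ) ∣ n := by
    rintro ⟨m, rfl⟩
    apply hbP
    have : b = (b - ((p * m : ℤ) : 𝓞 K)) + p * (m : 𝓞 K) := by push_cast; ring
    rw [this]
    exact P.add_mem hn (P.mul_mem_right _ hpP)
  have hsm : ∀ (k : ℤ) (x : 𝓞 K), Algebra.trace ℤ (𝓞 K) ((k : 𝓞 K) * x)
      = k * Algebra.trace ℤ (𝓞 K) x := fun k x => by
    rw [← zsmul_eq_mul, map_zsmul, smul_eq_mul]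
  have hc1 : Algebra.trace ℤ (𝓞 K) (1 : 𝓞 K) = 3 := by
    have := Algebra.trace_algebraMap (S := 𝓞 K) (1 : ℤ)
    rw [hK'] at this
    simpa using this
  obtain ⟨t1, ht1⟩ := htr a haP
  obtain ⟨t2, ht2⟩ := htr (a ^ 2) (P.pow_mem_of_mem haP 2 (by norm_num))
  obtain ⟨t3, ht3⟩ := htr _ hn
  obtain ⟨t4, ht4⟩ := htr (a * b) (P.mul_mem_right _ haP)
  have hb3 : Algebra.trace ℤ (𝓞 K) (a ^ 3) = p * (3 * n + p * t3) := by
    have h1 : a ^ 3 = ((p : ℤ) : 𝓞 K) * (((n : ℤ) : 𝓞 K) * 1 + (b - n)) := by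
      rw [hb]; push_cast; ring
    rw [h1, hsm, map_add, hsm, hc1, ht3]
    ring
  have hb4 : Algebra.trace ℤ (𝓞 K) (a ^ 4) = p * (p * t4) := by
    have h1 : a ^ 4 = ((p : ℤ) : 𝓞 K) * (a * b) := by
      rw [pow_succ, hb]; push_cast; ring
    rw [h1, hsm, ht4]
  obtain ⟨s, hs⟩ := exists_discr_eq_sq_mul K 3 hK ![1, a, a ^ 2]
  rw [Algebra.discr_def, Matrix.det_fin_three] at hs
  have e1 : a * a = a ^ 2 := by ring
  have e2 : a * a ^ 2 = a ^ 3 := by ring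
  have e3 : a ^ 2 * a = a ^ 3 := by ring
  have e4 : a ^ 2 * a ^ 2 = a ^ 4 := by ring
  simp [Algebra.traceMatrix_apply, Algebra.traceForm_apply, e1, e2, e3, e4, hc1, ht1, ht2,
    hb3, hb4] at hs
  refine ⟨s, _, n, 3 * t2 * t4 - 18 * n * t3 - 3 * p * t3 ^ 2 - p * t1 ^ 2 * t4
    + 2 * t1 * t2 * (3 * n + p * t3) - t2 ^ 3, ?_, rfl, hpn⟩
  rw [← hs]
  ring

/-- Lemma 2.1 (Hasse): for a cubic field of resolvent discriminant `d` and a totally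
ramified prime `p ≥ 5`, one has `(d/p) = 1` iff `p ≡ 1 (mod 3)`. -/
theorem legendreSym_resolvent_eq_one_iff
    (K : Type*) [Field K] [NumberField K] (hK : Module.finrank ℚ K = 3)
    (d : ℤ) (hd : IsResolventDiscrOf (NumberField.discr K) d)
    (p : ℕ) (hp : p.Prime) (hp5 : 5 ≤ p) (hram : TotallyRamified p K) :
    @legendreSym p ⟨hp⟩ d = 1 ↔ p % 3 = 1 := by
  haveI : Fact p.Prime := ⟨hp⟩
  obtain ⟨s, u, n, k, hs, hu, hn⟩ := cubic_discr K hK p hram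
  have hpZ : Prime (p : ℤ) := Nat.prime_iff_prime_int.1 hp
  have hp0 : (p : ℤ) ≠ 0 := hpZ.ne_zero
  have hn0 : (n : ZMod p) ≠ 0 := by
    rwa [Ne, ZMod.intCast_zmod_eq_zero_iff_dvd]
  have hnat : ∀ m : ℕ, 0 < m → m < p → (m : ZMod p) ≠ 0 := fun m h0 h1 h => by
    rw [ZMod.natCast_eq_zero_iff] at h
    exact absurd (Nat.le_of_dvd h0 h) (by omega)
  have h2 : (2 : ZMod p) ≠ 0 := by exact_mod_cast hnat 2 (by norm_num) (by omega)
  have h3 : (3 : ZMod p) ≠ 0 := by exact_mod_cast hnat 3 (by norm_num) (by omega)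
  have hu' : (u : ZMod p) = -3 * (3 * n) ^ 2 := by
    rw [hu]; push_cast; simp; ring
  have hu0 : (u : ZMod p) ≠ 0 := by
    rw [hu']
    exact mul_ne_zero (neg_ne_zero.2 h3) (pow_ne_zero _ (mul_ne_zero h3 hn0))
  have hsq : ∀ x y : ZMod p, y ≠ 0 → (IsSquare (x * y ^ 2) ↔ IsSquare x) := by
    intro x y hy
    constructor
    · rintro ⟨r, hr⟩
      refine ⟨r / y, ?_⟩
      field_simp
      rw [hr]; ring
    · rintro ⟨r, rfl⟩
      exact ⟨r * y, by ring⟩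
  have husq : IsSquare (u : ZMod p) ↔ p % 3 = 1 := by
    rw [hu', hsq _ _ (mul_ne_zero h3 hn0), legendre_neg_three p hp5]
  rcases hd with ⟨⟨r, hr⟩, rfl⟩ | ⟨hns, x, hx, hdx⟩
  · have h1 : IsSquare (u : ZMod p) := by
      have hdvd : (p : ℤ) ∣ s * r := by
        apply hpZ.dvd_of_dvd_pow (n := 2)
        exact ⟨p * u, by rw [hr] at hs; linear_combination hs⟩
      obtain ⟨q, hq⟩ := hdvd
      have : u = q * q := by
        have h5 : (p : ℤ) ^ 2 * u = p ^ 2 * (q * q) := by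
          rw [← hs, hr]; linear_combination (s * r + p * q) * hq
        exact mul_left_cancel₀ (pow_ne_zero 2 hp0) h5
      exact ⟨q, by rw [this]; push_cast; rfl⟩
    simp [husq.1 h1]
  · letI : FiniteDimensional ℚ ℚ⟮x⟯ := adjoin.finiteDimensional (isIntegral_of_sq _ x hx)
    letI : NumberField ℚ⟮x⟯ := ⟨⟩
    replace hdx : d = NumberField.discr ℚ⟮x⟯ := hdx
    have hint := isIntegral_of_sq _ x hx
    have hirr : Irreducible (X ^ 2 - C ((NumberField.discr K : ℤ) : ℚ)) := by
      apply X_pow_sub_C_irreducible_of_prime Nat.prime_two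
      intro b hb
      apply hns
      rw [← Rat.isSquare_intCast_iff]
      exact ⟨b, by rw [← hb, pow_two]⟩
    have hmin : minpoly ℚ x = X ^ 2 - C ((NumberField.discr K : ℤ) : ℚ) := by
      symm
      apply minpoly.eq_of_irreducible_of_monic hirr _ (monic_X_pow_sub_C _ two_ne_zero)
      simp [hx]
    have hrank : Module.finrank ℚ ℚ⟮x⟯ = 2 := by
      rw [adjoin.finrank hint, hmin, natDegree_X_pow_sub_C]
    have htr : Algebra.trace ℚ ℚ⟮x⟯ (AdjoinSimple.gen ℚ x) = 0 := by
      have h0 : -(minpoly ℚ x).nextCoeff = 0 := by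
        rw [hmin, nextCoeff, natDegree_X_pow_sub_C, if_neg two_ne_zero, coeff_sub, coeff_X_pow,
          coeff_C]
        simp
      exact (trace_adjoinSimpleGen hint).trans h0
    let y : ℚ⟮x⟯ := ((s : ℚ) / p) • AdjoinSimple.gen ℚ x
    have hgen : (AdjoinSimple.gen ℚ x) ^ 2 = ((NumberField.discr K : ℤ) : ℚ⟮x⟯) := by
      apply Subtype.ext
      push_cast
      simpa using hx
    have hy2 : y ^ 2 = ((u : ℤ) : ℚ⟮x⟯) := by
      have hpq : (p : ℚ⟮x⟯) ≠ 0 := by exact_mod_cast hp.ne_zero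
      have hs' : (s : ℚ⟮x⟯) ^ 2 * ((NumberField.discr K : ℤ) : ℚ⟮x⟯) = p ^ 2 * (u : ℚ⟮x⟯) := by
        exact_mod_cast congrArg (Int.cast : ℤ → ℚ⟮x⟯) hs
      simp only [y, Algebra.smul_def, mul_pow, hgen, map_div₀, map_intCast, map_natCast]
      field_simp
      exact hs'
    have hyint : IsIntegral ℤ y := by
      refine ⟨X ^ 2 - C u, monic_X_pow_sub_C _ two_ne_zero, ?_⟩
      rw [eval₂_sub, eval₂_X_pow, eval₂_C, hy2]
      simp
    obtain ⟨t, ht⟩ := quad_discr ℚ⟮x⟯ hrank y hyint u hy2 (by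
      change Algebra.trace ℚ ℚ⟮x⟯ y = 0
      rw [map_smul, htr, smul_zero])
    rw [← hdx] at ht
    have ht' : (u : ZMod p) * 2 ^ 2 = d * (t : ZMod p) ^ 2 := by
      have := congrArg (Int.cast : ℤ → ZMod p) ht
      push_cast at this
      linear_combination this
    have hne : (d : ZMod p) * (t : ZMod p) ^ 2 ≠ 0 := by
      rw [← ht']; exact mul_ne_zero hu0 (pow_ne_zero 2 h2)
    have hd0 : (d : ZMod p) ≠ 0 := left_ne_zero_of_mul hne
    have ht0 : (t : ZMod p) ≠ 0 := fun h => hne (by rw [h]; ring)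
    rw [legendreSym.eq_one_iff p hd0, ← hsq _ _ ht0, ← ht', hsq _ _ h2, husq]

end
end

section
/- Assume Setting (S). Then for each 1 ≤ i ≤ k, if K is a cubic field whose discriminant satisfies Δ_K ≡ a + i (mod m), then h(K) > H. -/
open NumberField IntermediateField Polynomial

noncomputable section

/-- If `y ∈ (p)` then the reduction mod `p` of its left-multiplication matrix vanishes. -/
lemma leftMul_map_eq_zero {K : Type} [Field K] [NumberField K] {p : ℕ} {y : 𝓞 K}
    (hy : y ∈ Ideal.span {(p : 𝓞 K)}) :
    ((Algebra.leftMulMatrix (RingOfIntegers.basis K)) y).map (Int.castRingHom (ZMod p)) = 0 := by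
  obtain ⟨z, rfl⟩ := Ideal.mem_span_singleton.1 hy
  have : (p : 𝓞 K) * z = (p : ℤ) • z := by simp
  rw [this, map_zsmul]
  ext i j
  rw [Matrix.map_apply, Matrix.smul_apply]
  simp

lemma mem_of_leftMul_map_eq_zero {K : Type} [Field K] [NumberField K] {p : ℕ} {y : 𝓞 K}
    (hy : ((Algebra.leftMulMatrix (RingOfIntegers.basis K)) y).map
      (Int.castRingHom (ZMod p)) = 0) :
    y ∈ Ideal.span {(p : 𝓞 K)} := by
  set b := RingOfIntegers.basis K with hb
  have h1 : ∀ z ∈ Submodule.span ℤ (Set.range b), y * z ∈ Ideal.span {(p : 𝓞 K)} := by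
    intro z hz
    induction hz using Submodule.span_induction with
    | mem z h =>
      obtain ⟨j, rfl⟩ := h
      rw [← b.sum_repr (y * b j)]
      refine Ideal.sum_mem _ fun i _ => ?_
      have h2 := congrFun (congrFun hy i) j
      rw [Matrix.map_apply, Algebra.leftMulMatrix_eq_repr_mul] at h2
      simp only [eq_intCast, Matrix.zero_apply] at h2
      rw [ZMod.intCast_zmod_eq_zero_iff_dvd] at h2
      obtain ⟨c, hc⟩ := h2
      rw [hc, Ideal.mem_span_singleton]
      exact ⟨c • b i, by simp [mul_assoc]⟩
    | zero => simp
    | add z w _ _ h1 h2 => rw [mul_add]; exact Ideal.add_mem _ h1 h2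
    | smul c z _ h => 
      rw [mul_smul_comm, zsmul_eq_mul]; exact Ideal.mul_mem_left _ _ h
  have := h1 1 (by rw [b.span_eq]; trivial)
  simpa using this

lemma idem_matrix_aux {ι : Type*} [Fintype ι] [DecidableEq ι] {p : ℕ} [Fact p.Prime] (hp5 : 5 ≤ p)
    (hι : Fintype.card ι = 3) (M : Matrix ι ι (ZMod p)) (hMM : M * M = M) (htr0 : M.trace = 0) :
    M = 0 := by
  have hff : IsIdempotentElem (Matrix.toLin' M) := by
    unfold IsIdempotentElem
    rw [Module.End.mul_eq_comp, ← Matrix.toLin'_mul, hMM]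
  have h4 := (LinearMap.IsIdempotentElem.isProj_range _ hff).trace
  rw [Matrix.trace_toLin'_eq, htr0] at h4
  have h5 : Module.finrank (ZMod p) (LinearMap.range (Matrix.toLin' M)) = 0 := by
    have h6 : Module.finrank (ZMod p) (LinearMap.range (Matrix.toLin' M)) ≤ 3 := by
      refine (Submodule.finrank_le _).trans ?_
      rw [Module.finrank_fintype_fun_eq_card, hι]
    have h7 := (ZMod.natCast_eq_zero_iff _ p).1 h4.symm
    exact Nat.eq_zero_of_dvd_of_lt h7 (by omega)
  rw [Submodule.finrank_eq_zero, LinearMap.range_eq_bot] at h5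
  simpa using h5

lemma idem_trace_aux {K : Type} [Field K] [NumberField K] (h3 : Module.finrank ℚ K = 3)
    {p : ℕ} (hp : p.Prime) (hp5 : 5 ≤ p) (x : 𝓞 K)
    (hidem : x * x - x ∈ Ideal.span {(p : 𝓞 K)})
    (htr : (p : ℤ) ∣ Algebra.trace ℤ (𝓞 K) x) : x ∈ Ideal.span {(p : 𝓞 K)} := by
  have : Fact p.Prime := ⟨hp⟩
  apply mem_of_leftMul_map_eq_zero
  apply idem_matrix_aux hp5
  · rw [← Module.finrank_eq_card_chooseBasisIndex, RingOfIntegers.rank, h3]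
  · have h2 := leftMul_map_eq_zero hidem
    rw [map_sub, map_mul, Matrix.map_sub _ (by simp), Matrix.map_mul] at h2
    exact sub_eq_zero.1 h2
  · rw [Algebra.trace_eq_matrix_trace (RingOfIntegers.basis K)] at htr
    have h2 := (ZMod.intCast_zmod_eq_zero_iff_dvd _ p).2 htr
    rw [← h2]
    simp [Matrix.trace]

lemma map_span_natCast (K : Type) [Field K] [NumberField K] (p : ℕ) :
    Ideal.map (algebraMap ℤ (𝓞 K)) (Ideal.span {(p : ℤ)}) = Ideal.span {(p : 𝓞 K)} := by
  rw [Ideal.map_span]; simp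

lemma not_dvd_different_aux {K : Type} [Field K] [NumberField K] (I Q : Ideal (𝓞 K)) (p : ℕ)
    (x : 𝓞 K) (hx : x ∈ Q)
    (h : I * Q = Ideal.map (algebraMap ℤ (𝓞 K)) (Ideal.span {(p : ℤ)}))
    (h2 : Algebra.intTrace ℤ (𝓞 K) x ∉ Ideal.span {(p : ℤ)}) :
    ¬ I ∣ differentIdeal ℤ (𝓞 K) :=
  not_dvd_differentIdeal_of_intTrace_not_mem ℤ I Q h x hx h2

lemma idem_ring_aux {R : Type*} [CommRing R] (x y : R) (hxy : y + x = 1) :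
    x * x - x = (-y) * x := by
  linear_combination x * hxy

lemma eq_top_aux {R : Type*} [CommRing R] (I Q S : Ideal R) (h : I * Q = S) (x y : R)
    (hy : y ∈ I) (hx : x ∈ S) (hxy : y + x = 1) : I = ⊤ := by
  rw [Ideal.eq_top_iff_one, ← hxy]
  refine I.add_mem hy ?_
  rw [← h] at hx
  exact Ideal.mul_le_left hx

lemma tame_aux2 {K : Type} [Field K] [NumberField K] (h3 : Module.finrank ℚ K = 3)
    {p : ℕ} (hp : p.Prime) (hp5 : 5 ≤ p) (I Q : Ideal (𝓞 K)) (hI : I ≠ ⊤)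
    (hIQ : I * Q = Ideal.span {(p : 𝓞 K)}) (x y : 𝓞 K) (hy : y ∈ I) (hx : x ∈ Q)
    (hxy : y + x = 1) : ¬ (p : ℤ) ∣ Algebra.trace ℤ (𝓞 K) x := by
  intro htr
  have hidem : x * x - x ∈ Ideal.span {(p : 𝓞 K)} := by
    rw [← hIQ]
    rw [idem_ring_aux x y hxy]
    exact Ideal.mul_mem_mul (neg_mem hy) hx
  have h9 := idem_trace_aux h3 hp hp5 x hidem htr
  exact hI (eq_top_aux I Q _ hIQ x y hy h9 hxy)

lemma tame_aux {K : Type} [Field K] [NumberField K] (h3 : Module.finrank ℚ K = 3)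
    {p : ℕ} (hp : p.Prime) (hp5 : 5 ≤ p) (I Q : Ideal (𝓞 K)) (hI : I ≠ ⊤)
    (hIQ : I * Q = Ideal.span {(p : 𝓞 K)}) (hc : IsCoprime I Q) :
    ¬ I ∣ differentIdeal ℤ (𝓞 K) := by
  obtain ⟨y, hy, x, hx, hxy⟩ := Ideal.isCoprime_iff_exists.1 hc
  have h1 := tame_aux2 h3 hp hp5 I Q hI hIQ x y hy hx hxy
  refine not_dvd_different_aux I Q p x hx (by rw [map_span_natCast]; exact hIQ) ?_
  rw [Algebra.intTrace_eq_trace, Ideal.mem_span_singleton]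
  exact h1

lemma exists_maximal_of_dvd_absNorm {K : Type} [Field K] [NumberField K] {p : ℕ} (hp : p.Prime)
    (J : Ideal (𝓞 K)) (hJ : p ∣ Ideal.absNorm J) :
    ∃ P : Ideal (𝓞 K), P.IsMaximal ∧ P ∣ J ∧ (p : 𝓞 K) ∈ P := by
  have : Fact p.Prime := ⟨hp⟩
  by_cases h0 : J = ⊥
  · subst h0
    have : Ideal.span {(p : 𝓞 K)} ≠ ⊤ := by
      intro h
      have h2 := Ideal.absNorm_span_natCast (S := 𝓞 K) p
      rw [h, Ideal.absNorm_top] at h2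
      have := Nat.pow_eq_one.1 h2.symm
      have h4 : Module.finrank ℤ (𝓞 K) ≠ 0 := by
        rw [RingOfIntegers.rank]; exact Module.finrank_pos.ne'
      have := hp.one_lt
      omega
    obtain ⟨P, hP, h⟩ := Ideal.exists_le_maximal _ this
    exact ⟨P, hP, dvd_zero P, h (Ideal.mem_span_singleton_self _)⟩
  have hfin : Finite (𝓞 K ⧸ J) := Ideal.finiteQuotientOfFreeOfNeBot J h0
  have hc : p ∣ Nat.card (𝓞 K ⧸ J) := by
    rw [Ideal.absNorm_apply] at hJ
    exact hJ
  obtain ⟨x, hx⟩ := exists_prime_addOrderOf_dvd_card' p hc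
  obtain ⟨x, rfl⟩ := Ideal.Quotient.mk_surjective x
  have h1 : (p : 𝓞 K) * x ∈ J := by
    rw [← Ideal.Quotient.eq_zero_iff_mem, map_mul, map_natCast, ← nsmul_eq_mul, ← hx]
    exact addOrderOf_nsmul_eq_zero _
  have h2 : x ∉ J := by
    intro h
    rw [Ideal.Quotient.eq_zero_iff_mem.2 h, addOrderOf_zero] at hx
    exact hp.one_lt.ne hx
  have h3 : J ⊔ Ideal.span {(p : 𝓞 K)} ≠ ⊤ := by
    intro h
    rw [Ideal.eq_top_iff_one, Submodule.mem_sup] at h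
    obtain ⟨j, hj, r, hr, hjr⟩ := h
    obtain ⟨r, rfl⟩ := Ideal.mem_span_singleton.1 hr
    apply h2
    have : x = j * x + r * (p * x) := by
      linear_combination (-x) * hjr
    rw [this]
    exact J.add_mem (J.mul_mem_right _ hj) (J.mul_mem_left _ h1)
  obtain ⟨P, hP, h⟩ := Ideal.exists_le_maximal _ h3
  exact ⟨P, hP, Ideal.dvd_iff_le.2 (le_sup_left.trans h),
    h (Ideal.mem_sup_right (Ideal.mem_span_singleton_self _))⟩

/-- A prime `p ≥ 5` with `p² ∣ Δ_K` is totally ramified in the cubic field `K`. -/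
lemma totally_ramified {K : Type} [Field K] [NumberField K] (h3 : Module.finrank ℚ K = 3)
    {p : ℕ} (hp : p.Prime) (hp5 : 5 ≤ p) (hd : (p : ℤ) ^ 2 ∣ NumberField.discr K) :
    ∃ P : Ideal (𝓞 K), P ^ 3 = Ideal.span {(p : 𝓞 K)} ∧ Ideal.absNorm P = p := by
  have hN : Ideal.absNorm (Ideal.span {(p : 𝓞 K)}) = p ^ 3 := by
    rw [Ideal.absNorm_span_natCast, RingOfIntegers.rank, h3]
  have hd' : p ^ 2 ∣ Ideal.absNorm (differentIdeal ℤ (𝓞 K)) := by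
    rw [absNorm_differentIdeal K (𝓞 K), ← Int.natCast_dvd]
    exact_mod_cast hd
  obtain ⟨P, hPm, hPd, hpP⟩ := exists_maximal_of_dvd_absNorm hp _ ((dvd_pow_self p two_ne_zero).trans hd')
  have hPp : P ∣ Ideal.span {(p : 𝓞 K)} := by
    rw [Ideal.dvd_span_singleton]; exact hpP
  obtain ⟨Q, hQ⟩ := hPp
  have hPQ : P ∣ Q := by
    by_contra h
    refine tame_aux h3 hp hp5 P Q hPm.ne_top hQ.symm ?_ hPd
    rw [Ideal.isCoprime_iff_sup_eq]
    by_contra h1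
    have h2 := hPm.eq_of_le h1 le_sup_left
    exact h (Ideal.dvd_iff_le.2 (by rw [h2]; exact le_sup_right))
  obtain ⟨R, rfl⟩ := hPQ
  have hPN : Ideal.absNorm P ≠ 1 := by
    rw [Ne, Ideal.absNorm_eq_one_iff]; exact hPm.ne_top
  have hN2 : p ^ 3 = Ideal.absNorm P * (Ideal.absNorm P * Ideal.absNorm R) := by
    rw [← hN, hQ, map_mul, map_mul]
  have hPp : Ideal.absNorm P = p := by
    obtain ⟨s, hs, hs'⟩ := (Nat.dvd_prime_pow hp).1 (Dvd.intro _ hN2.symm)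
    rw [hs'] at hN2 hPN ⊢
    have hs0 : s ≠ 0 := by rintro rfl; simp at hPN
    have : s < 2 := by
      by_contra h
      have h1 : p ^ 4 ∣ p ^ 3 := by
        refine (pow_dvd_pow p (show 4 ≤ s + s by omega)).trans ?_
        rw [hN2, pow_add, ← mul_assoc]
        exact Dvd.intro _ rfl
      have := (Nat.pow_dvd_pow_iff_le_right hp.one_lt).1 h1
      omega
    have : s = 1 := by omega
    simp [this]
  have hRp : Ideal.absNorm R = p := by
    rw [hPp] at hN2
    have h1 : p * p * p = p * p * Ideal.absNorm R := by rw [mul_assoc p p (Ideal.absNorm R), ← hN2]; ring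
    exact (Nat.eq_of_mul_eq_mul_left (Nat.mul_pos hp.pos hp.pos) h1).symm
  by_cases hRP : R = P
  · exact ⟨P, by rw [hQ, hRP]; ring, hPp⟩
  exfalso
  have hRprime : R.IsPrime := Ideal.isPrime_of_irreducible_absNorm (by rw [hRp]; exact hp)
  have hR0 : R ≠ ⊥ := by rintro rfl; simp at hRp; exact hp.pos.ne hRp
  have hP0 : P ≠ ⊥ := by rintro rfl; simp at hPp; exact hp.pos.ne hPp
  have hRm : R.IsMaximal := hRprime.isMaximal hR0
  have hcop : IsCoprime P R := by
    rw [Ideal.isCoprime_iff_sup_eq]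
    exact Ideal.IsMaximal.coprime_of_ne hPm hRm (Ne.symm hRP)
  have hcop2 : IsCoprime (P ^ 2) R := hcop.pow_left
  have t1 := tame_aux h3 hp hp5 (P ^ 2) R (fun h => hPm.ne_top (by
    rw [Ideal.eq_top_iff_one] at h ⊢; exact Ideal.pow_le_self two_ne_zero h)) (by rw [hQ]; ring) hcop2
  have t2 := tame_aux h3 hp hp5 R (P ^ 2) hRm.ne_top (by rw [hQ]; ring) hcop2.symm
  obtain ⟨J, hJ⟩ := hPd
  rw [hJ] at hd' t1 t2
  rw [map_mul, hPp, pow_two] at hd'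
  have hpJ := Nat.dvd_of_mul_dvd_mul_left hp.pos hd'
  obtain ⟨P', hm', hd2, hp'⟩ := exists_maximal_of_dvd_absNorm hp _ hpJ
  have hP'0 : P' ≠ ⊥ := by
    rintro rfl
    have : (p : 𝓞 K) = 0 := hp'
    exact hp.ne_zero (by exact_mod_cast this)
  have hpr : Prime P' := Ideal.prime_of_isPrime hP'0 hm'.isPrime
  have : P' ∣ P * (P * R) := by
    rw [← hQ, Ideal.dvd_span_singleton]; exact hp'
  have key : ∀ S : Ideal (𝓞 K), S.IsMaximal → P' ∣ S → P' = S := fun S hS h =>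
    (hS.eq_of_le hm'.ne_top (Ideal.dvd_iff_le.1 h)).symm
  rcases hpr.dvd_or_dvd this with h | h
  · have := key P hPm h
    subst this
    exact t1 (by rw [pow_two]; exact mul_dvd_mul_left _ hd2)
  rcases hpr.dvd_or_dvd h with h | h
  · have := key P hPm h
    subst this
    exact t1 (by rw [pow_two]; exact mul_dvd_mul_left _ hd2)
  · have := key R hRm h
    subst this
    exact t2 (hd2.mul_left _)

/-- In the totally ramified case norms are cubes mod `p`. -/
lemma norm_cube {K : Type} [Field K] [NumberField K] (h3 : Module.finrank ℚ K = 3)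
    {p : ℕ} (hp : p.Prime) (hp5 : 5 ≤ p) (P : Ideal (𝓞 K))
    (hP : P ^ 3 = Ideal.span {(p : 𝓞 K)}) (hN : Ideal.absNorm P = p) (γ : 𝓞 K) :
    ∃ a : ZMod p, ((Algebra.norm ℤ γ : ℤ) : ZMod p) = a ^ 3 := by
  have : Fact p.Prime := ⟨hp⟩
  have hpP : (p : 𝓞 K) ∈ P := by
    have := Ideal.absNorm_mem P
    rwa [hN] at this
  -- residue
  obtain ⟨a, ha⟩ : ∃ a : ℕ, γ - a ∈ P := by
    have hP0 : P ≠ ⊥ := by rintro rfl; simp at hN; exact hp.pos.ne hN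
    have hfin : Finite (𝓞 K ⧸ P) := Ideal.finiteQuotientOfFreeOfNeBot P hP0
    have hcard : Nat.card (𝓞 K ⧸ P) = p := by
      rw [Ideal.absNorm_apply] at hN; exact hN
    have hc : CharP (𝓞 K ⧸ P) p := by
      have h0 : ((p : ℕ) : 𝓞 K ⧸ P) = 0 := by
        rw [← map_natCast (Ideal.Quotient.mk P), Ideal.Quotient.eq_zero_iff_mem]; exact hpP
      have hnt : Nontrivial (𝓞 K ⧸ P) := by
        rw [← Finite.one_lt_card_iff_nontrivial, hcard]; exact hp.one_lt
      refine (CharP.charP_iff_prime_eq_zero hp).2 h0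
    let f : ZMod p →+* 𝓞 K ⧸ P := ZMod.castHom dvd_rfl _
    have hinj : Function.Injective f := ZMod.castHom_injective _
    have hbij : Function.Bijective f :=
      (Nat.bijective_iff_injective_and_card f).2 ⟨hinj, by rw [hcard, Nat.card_zmod]⟩
    obtain ⟨z, hz⟩ := hbij.2 (Ideal.Quotient.mk P γ)
    refine ⟨z.val, ?_⟩
    rw [← Ideal.Quotient.eq_zero_iff_mem, map_sub, ← hz, map_natCast]
    conv_lhs => rw [← ZMod.natCast_zmod_val z]
    rw [map_natCast]; simp
  -- p-th power
  have hpow : γ ^ p - (a : 𝓞 K) ^ p ∈ Ideal.span {(p : 𝓞 K)} := by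
    obtain ⟨r, hr⟩ := exists_add_pow_prime_eq hp (γ - a) (a : 𝓞 K)
    rw [sub_add_cancel] at hr
    have h1 : γ ^ p - (a : 𝓞 K) ^ p = (γ - a) ^ p + p * ((γ - a) * a * r) := by
      rw [hr]; ring
    rw [h1]
    refine Ideal.add_mem _ ?_ (Ideal.mul_mem_right _ _ (Ideal.mem_span_singleton_self _))
    rw [← hP]
    exact Ideal.pow_le_pow_right (show 3 ≤ p by omega) (Ideal.pow_mem_pow ha p)
  have hmat := leftMul_map_eq_zero hpow
  rw [map_sub, Matrix.map_sub _ (by simp), sub_eq_zero] at hmat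
  have hdet := congrArg Matrix.det hmat
  have hmd : ∀ x : 𝓞 K, ((Algebra.leftMulMatrix (RingOfIntegers.basis K) x).map
      (Int.castRingHom (ZMod p))).det = ((Algebra.norm ℤ x : ℤ) : ZMod p) := by
    intro x
    rw [Algebra.norm_eq_matrix_det (RingOfIntegers.basis K)]
    have := RingHom.map_det (Int.castRingHom (ZMod p)) (Algebra.leftMulMatrix (RingOfIntegers.basis K) x)
    rw [RingHom.mapMatrix_apply] at this
    rw [← this]; simp
  rw [hmd, hmd, map_pow, map_pow] at hdet
  have hna : Algebra.norm ℤ (a : 𝓞 K) = (a : ℤ) ^ 3 := by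
    have := Algebra.norm_algebraMap_of_basis (RingOfIntegers.basis K) (a : ℤ)
    rw [← Module.finrank_eq_card_chooseBasisIndex, RingOfIntegers.rank, h3] at this
    simpa using this
  rw [hna] at hdet
  push_cast at hdet
  rw [ZMod.pow_card, ZMod.pow_card] at hdet
  exact ⟨a, hdet⟩

/-- Stickelberger: if `ℓ` is inert in a cubic field, then the discriminant is a square mod `ℓ`. -/
lemma det_aux {F : Type*} [Field F] {ℓ : ℕ} [Fact ℓ.Prime] [CharP F ℓ] 
    (x y z : F) (hx : x ^ ℓ ^ 3 = x) (hy : y ^ ℓ ^ 3 = y) (hz : z ^ ℓ ^ 3 = z) :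
    ∃ s : F, s ^ ℓ = s ∧ 
      Matrix.det (Matrix.of fun i j : Fin 3 => ∑ k ∈ Finset.range 3, (![x,y,z] i * ![x,y,z] j) ^ ℓ ^ k)
      = s ^ 2 := by
  refine ⟨x * (y^ℓ * z^ℓ^2 - z^ℓ * y^ℓ^2) - y * (x^ℓ * z^ℓ^2 - z^ℓ * x^ℓ^2) + z * (x^ℓ * y^ℓ^2 - y^ℓ * x^ℓ^2), ?_, ?_⟩
  · simp only [add_pow_char, sub_pow_char, mul_pow, ← pow_mul]
    have e1 : ℓ * ℓ = ℓ ^ 2 := by ring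
    have e2 : ℓ ^ 2 * ℓ = ℓ ^ 3 := by ring
    simp only [e1, e2, hx, hy, hz]
    ring
  · simp [Matrix.det_fin_three, Finset.sum_range_succ, mul_pow]
    ring

lemma inert_square {K : Type} [Field K] [NumberField K] (h3 : Module.finrank ℚ K = 3)
    {ℓ : ℕ} (hl : ℓ.Prime) (hin : (Ideal.span {(ℓ : 𝓞 K)}).IsMaximal) :
    IsSquare ((NumberField.discr K : ℤ) : ZMod ℓ) := by
  have : Fact ℓ.Prime := ⟨hl⟩
  have hmap := map_span_natCast K ℓ
  have hlm : (Ideal.span {(ℓ : ℤ)}).IsMaximal := by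
    have := (Ideal.span_singleton_prime (p := (ℓ : ℤ)) (by exact_mod_cast hl.ne_zero)).2 (Nat.prime_iff_prime_int.1 hl)
    exact this.isMaximal (by simpa using hl.ne_zero)
  set p : Ideal ℤ := Ideal.span {(ℓ : ℤ)} with hp
  set I : Ideal (𝓞 K) := Ideal.map (algebraMap ℤ (𝓞 K)) p with hI
  have hIm : I.IsMaximal := by rw [hmap]; exact hin
  let _ : Field (ℤ ⧸ p) := Ideal.Quotient.field p
  let _ : Field (𝓞 K ⧸ I) := Ideal.Quotient.field I
  have hnorm : Nat.card (𝓞 K ⧸ I) = ℓ ^ 3 := by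
    have := Ideal.absNorm_span_natCast (S := 𝓞 K) ℓ
    rw [RingOfIntegers.rank, h3, ← hmap, Ideal.absNorm_apply] at this
    exact this
  have hfin : Finite (𝓞 K ⧸ I) := Nat.finite_of_card_ne_zero (by rw [hnorm]; exact pow_ne_zero _ hl.ne_zero)
  have hcardp : Nat.card (ℤ ⧸ p) = ℓ := by
    rw [Nat.card_congr (Int.quotientSpanNatEquivZMod ℓ).toEquiv, Nat.card_zmod]
  have hfr : Module.finrank (ℤ ⧸ p) (𝓞 K ⧸ I) = 3 := by
    have : Finite (ℤ ⧸ p) := Nat.finite_of_card_ne_zero (by rw [hcardp]; exact hl.ne_zero)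
    have h1 := Module.natCard_eq_pow_finrank (K := ℤ ⧸ p) (V := 𝓞 K ⧸ I)
    rw [hnorm, hcardp] at h1
    exact (Nat.pow_right_injective hl.two_le h1).symm
  have hch : CharP (𝓞 K ⧸ I) ℓ := by
    refine (CharP.charP_iff_prime_eq_zero hl).2 ?_
    rw [← map_natCast (Ideal.Quotient.mk I), Ideal.Quotient.eq_zero_iff_mem, hmap]
    exact Ideal.mem_span_singleton_self _
  have hcard : Fintype.card (Module.Free.ChooseBasisIndex ℤ (𝓞 K)) = 3 := by
    rw [← Module.finrank_eq_card_chooseBasisIndex, RingOfIntegers.rank, h3]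
  let e := Fintype.equivFinOfCardEq hcard
  let b := (RingOfIntegers.basis K).reindex e
  have hD : NumberField.discr K = Algebra.discr ℤ b := by
    unfold NumberField.discr
    simp only [b, Module.Basis.coe_reindex]
    exact (Algebra.discr_reindex ℤ _ _).symm
  have htr : ∀ x : 𝓞 K, Ideal.Quotient.mk I ((Algebra.trace ℤ (𝓞 K) x : ℤ) : 𝓞 K) =
      ∑ k ∈ Finset.range 3, (Ideal.Quotient.mk I x) ^ ℓ ^ k := by
    intro x
    have h1 := Algebra.trace_quotient_eq_of_isDedekindDomain (𝓞 K) p x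
    have h2 := FiniteField.algebraMap_trace_eq_sum_pow (ℤ ⧸ p) (𝓞 K ⧸ I) (Ideal.Quotient.mk I x)
    rw [h1, hfr, hcardp, Algebra.intTrace_eq_trace] at h2
    rw [← h2]
    rfl
  have hfrob : ∀ x : 𝓞 K ⧸ I, x ^ ℓ ^ 3 = x := by
    intro x
    have := Fintype.ofFinite (𝓞 K ⧸ I)
    rw [← hnorm, Nat.card_eq_fintype_card, FiniteField.pow_card]
  obtain ⟨s, hs, hs2⟩ := det_aux (ℓ := ℓ) (Ideal.Quotient.mk I (b 0)) (Ideal.Quotient.mk I (b 1))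
    (Ideal.Quotient.mk I (b 2)) (hfrob _) (hfrob _) (hfrob _)
  have hDs : ((NumberField.discr K : ℤ) : 𝓞 K ⧸ I) = s ^ 2 := by
    rw [← hs2, hD, Algebra.discr_def]
    have h1 := RingHom.map_det (Int.castRingHom (𝓞 K ⧸ I)) (Algebra.traceMatrix ℤ b)
    rw [eq_intCast] at h1
    rw [h1]
    congr 1
    ext i j
    have h2 := htr (b i * b j)
    rw [map_intCast] at h2
    rw [RingHom.mapMatrix_apply, Matrix.map_apply, Algebra.traceMatrix_apply, Algebra.traceForm_apply,
      eq_intCast, h2, map_mul, Matrix.of_apply]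
    fin_cases i <;> fin_cases j <;> rfl
  -- s in the prime field
  let f : ZMod ℓ →+* 𝓞 K ⧸ I := ZMod.castHom dvd_rfl _
  obtain ⟨t, ht⟩ : ∃ t : ZMod ℓ, f t = s := by
    have h1 : s ∈ (⊥ : Subfield (𝓞 K ⧸ I)) := (Subfield.mem_bot_iff_pow_eq_self (𝓞 K ⧸ I) ℓ).2 hs
    exact (bot_le : ⊥ ≤ f.fieldRange) h1
  refine ⟨t, f.injective ?_⟩
  rw [map_intCast, map_mul, ht, hDs, pow_two]

lemma exists_ideal_norm_eq {K : Type} [Field K] [NumberField K] (h3 : Module.finrank ℚ K = 3)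
    {ℓ : ℕ} (hl : ℓ.Prime) (hsq : ¬ IsSquare ((NumberField.discr K : ℤ) : ZMod ℓ)) :
    ∃ I : Ideal (𝓞 K), Ideal.absNorm I = ℓ := by
  have hN : Ideal.absNorm (Ideal.span {(ℓ : 𝓞 K)}) = ℓ ^ 3 := by
    rw [Ideal.absNorm_span_natCast, RingOfIntegers.rank, h3]
  obtain ⟨P, hPm, hPd, -⟩ := exists_maximal_of_dvd_absNorm hl _ (by rw [hN]; exact dvd_pow_self ℓ three_ne_zero)
  obtain ⟨Q, hQ⟩ := hPd
  rw [hQ, map_mul] at hN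
  have hPN : Ideal.absNorm P ≠ 1 := by
    rw [Ne, Ideal.absNorm_eq_one_iff]; exact hPm.ne_top
  obtain ⟨s, hs, hs'⟩ := (Nat.dvd_prime_pow hl).1 (Dvd.intro _ hN)
  interval_cases s
  · simp at hs'; exact absurd (by simpa using hs') hPN
  · exact ⟨P, by simpa using hs'⟩
  · refine ⟨Q, ?_⟩
    rw [hs'] at hN
    exact Nat.eq_of_mul_eq_mul_left (pow_pos hl.pos 2) (hN.trans (by ring))
  · exfalso
    rw [hs'] at hN
    have : Ideal.absNorm Q = 1 := Nat.eq_of_mul_eq_mul_left (pow_pos hl.pos 3) (hN.trans (by ring))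
    rw [Ideal.absNorm_eq_one_iff] at this
    rw [this, Ideal.mul_top] at hQ
    exact hsq (inert_square h3 hl (by rw [hQ]; exact hPm))

lemma class_eq_aux {K : Type} [Field K] [NumberField K] (h3 : Module.finrank ℚ K = 3)
    {p : ℕ} (hp : p.Prime) (hp12 : p % 12 = 1) (P : Ideal (𝓞 K))
    (hP : P ^ 3 = Ideal.span {(p : 𝓞 K)}) (hN : Ideal.absNorm P = p)
    (I I' : nonZeroDivisors (Ideal (𝓞 K))) (ℓ ℓ' : ℕ)
    (hI : Ideal.absNorm (I : Ideal (𝓞 K)) = ℓ) (hI' : Ideal.absNorm (I' : Ideal (𝓞 K)) = ℓ')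
    (hl : (ℓ : ZMod p) ≠ 0) (hl' : (ℓ' : ZMod p) ≠ 0)
    (hcl : ClassGroup.mk0 I = ClassGroup.mk0 I') :
    ((ℓ : ZMod p) * (ℓ' : ZMod p) ^ 2) ^ ((p - 1) / 3) = 1 := by
  have : Fact p.Prime := ⟨hp⟩
  have hp5 : 5 ≤ p := by have := hp.two_le; omega
  have hl0 : ℓ' ≠ 0 := by rintro rfl; simp at hl'
  have hmem : (ℓ' : 𝓞 K) ∈ (I' : Ideal (𝓞 K)) := by
    have := Ideal.absNorm_mem (I' : Ideal (𝓞 K))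
    rwa [hI'] at this
  obtain ⟨J, hJ⟩ := Ideal.dvd_span_singleton.2 hmem
  have hsp0 : Ideal.span {(ℓ' : 𝓞 K)} ≠ 0 := by
    simpa using hl0
  have hJ0 : J ≠ 0 := by
    rintro rfl
    rw [mul_zero] at hJ
    exact hsp0 hJ
  have hJN : Ideal.absNorm J = ℓ' ^ 2 := by
    have h1 := Ideal.absNorm_span_natCast (S := 𝓞 K) ℓ'
    rw [RingOfIntegers.rank, h3, hJ, map_mul, hI'] at h1
    exact Nat.eq_of_mul_eq_mul_left (Nat.pos_of_ne_zero hl0) (h1.trans (by ring))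
  let J' : nonZeroDivisors (Ideal (𝓞 K)) := ⟨J, mem_nonZeroDivisors_of_ne_zero hJ0⟩
  have hpr : ClassGroup.mk0 (I * J') = 1 := by
    rw [map_mul, hcl, ← map_mul]
    have h1 : I' * J' = ⟨Ideal.span {(ℓ' : 𝓞 K)}, mem_nonZeroDivisors_of_ne_zero hsp0⟩ :=
      Subtype.ext hJ.symm
    rw [h1, ClassGroup.mk0_eq_one_iff]
    infer_instance
  have hpr2 : Submodule.IsPrincipal ((I : Ideal (𝓞 K)) * J) :=
    (ClassGroup.mk0_eq_one_iff (I * J').2).1 hpr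
  obtain ⟨⟨γ, hγ⟩⟩ := hpr2
  have hγN : (Algebra.norm ℤ γ).natAbs = ℓ * ℓ' ^ 2 := by
    rw [← Ideal.absNorm_span_singleton, ← hJN, ← hI, ← map_mul, hγ]
  obtain ⟨a, ha⟩ := norm_cube h3 hp hp5 P hP hN γ
  have hev : Even ((p - 1) / 3) := by
    rw [Nat.even_iff]; omega
  have key : (((Algebra.norm ℤ γ : ℤ) : ZMod p)) ^ ((p - 1) / 3)
      = ((ℓ : ZMod p) * (ℓ' : ZMod p) ^ 2) ^ ((p - 1) / 3) := by
    rcases Int.natAbs_eq (Algebra.norm ℤ γ) with h | h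
    · rw [h, hγN]; push_cast; rfl
    · rw [h, hγN]; push_cast; rw [hev.neg_pow]
  rw [← key, ha, ← pow_mul, Nat.mul_div_cancel' (by omega)]
  apply ZMod.pow_card_sub_one_eq_one
  rintro rfl
  rw [ha] at key
  have h3' : (p - 1) / 3 ≠ 0 := by omega
  rw [zero_pow three_ne_zero, zero_pow h3'] at key
  exact pow_ne_zero _ (mul_ne_zero hl (pow_ne_zero 2 hl')) key.symm

lemma exists_cubic_nonresidue {p : ℕ} (hp : p.Prime) (hp12 : p % 12 = 1) :
    ∃ g : ℕ, (g : ZMod p) ≠ 0 ∧ (g : ZMod p) ^ ((p - 1) / 3) ≠ 1 := by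
  have : Fact p.Prime := ⟨hp⟩
  obtain ⟨u, hu⟩ := IsCyclic.exists_ofOrder_eq_natCard (α := (ZMod p)ˣ)
  rw [Nat.card_eq_fintype_card, ZMod.card_units] at hu
  have := hp.two_le
  refine ⟨(u : ZMod p).val, ?_, ?_⟩
  · rw [ZMod.natCast_zmod_val]; exact u.ne_zero
  · rw [ZMod.natCast_zmod_val]
    intro h
    have h1 : u ^ ((p - 1) / 3) = 1 := by ext; simpa using h
    have h2 := Nat.le_of_dvd (by omega) (orderOf_dvd_of_pow_eq_one h1)
    omega

lemma cubic_exp_aux {p : ℕ} (hp : p.Prime) (hp12 : p % 12 = 1) (g : ZMod p) (h0 : g ≠ 0)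
    (hg : g ^ ((p - 1) / 3) ≠ 1) (v w : Fin 3)
    (h : (g ^ (v : ℕ) * (g ^ (w : ℕ)) ^ 2) ^ ((p - 1) / 3) = 1) : v = w := by
  have : Fact p.Prime := ⟨hp⟩
  have hw3 : (g ^ ((p - 1) / 3)) ^ 3 = 1 := by
    rw [← pow_mul, Nat.div_mul_cancel (by omega), ZMod.pow_card_sub_one_eq_one h0]
  have ho : orderOf (g ^ ((p - 1) / 3)) = 3 := orderOf_eq_prime hw3 hg
  have h2 : (g ^ ((p - 1) / 3)) ^ ((v : ℕ) + 2 * w) = 1 := by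
    rw [← h]; ring
  have h3 := orderOf_dvd_of_pow_eq_one h2
  rw [ho] at h3
  omega

open NumberTheorySymbols in
lemma exists_prime_aux {n : ℕ} (p c : Fin n → ℕ) (hp : ∀ j, (p j).Prime)
    (hinj : Function.Injective p) (hodd : ∀ j, p j ≠ 2) (A : ℤ) (hA : ∀ j, ¬ (p j : ℤ) ∣ A)
    (hc : ∀ j, ¬ p j ∣ c j) (r : ℕ) (hr : Odd r) (hJ : J(A | r) = -1) :
    ∃ ℓ : ℕ, ℓ.Prime ∧ ¬ IsSquare (((A * (∏ j, (p j : ℤ)) ^ 2 : ℤ)) : ZMod ℓ) ∧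
      ∀ j, (ℓ : ZMod (p j)) = c j := by
  classical
  have hA0 : A ≠ 0 := by
    rintro rfl
    have : r ≠ 0 := by rintro rfl; simp at hr
    by_cases h1 : r = 1
    · subst h1; simp at hJ
    · have : 1 < r := by omega
      rw [jacobiSym.zero_left this] at hJ; simp at hJ
  set N := 4 * A.natAbs with hNdef
  have hN0 : N ≠ 0 := by simp [hNdef, hA0]
  have : NeZero r := ⟨by rintro rfl; simp at hr⟩
  have hcopA : A.gcd r = 1 := by
    by_contra h
    rw [jacobiSym.eq_zero_iff_not_coprime.2 h] at hJ
    · simp at hJ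
  have hcopr : Nat.Coprime r N := by
    rw [hNdef]
    refine Nat.Coprime.mul_right ?_ ?_
    · exact (Nat.Coprime.pow_right 2 (Nat.coprime_two_right.2 hr) : Nat.Coprime r (2 ^ 2))
    · rw [Nat.coprime_comm]; exact hcopA
  obtain ⟨x, hx⟩ := Nat.chineseRemainderOfFinset c p Finset.univ (fun i _ => (hp i).ne_zero)
    (fun i _ j _ hij => (Nat.coprime_primes (hp i) (hp j)).2 (fun h => hij (hinj h)))
  have hpN : ∀ j, Nat.Coprime (p j) N := by
    intro j
    rw [hNdef]
    refine Nat.Coprime.mul_right ?_ ?_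
    · exact (Nat.Coprime.pow_right 2 ((Nat.coprime_primes (hp j) Nat.prime_two).2 (hodd j)) :
        Nat.Coprime (p j) (2 ^ 2))
    · rw [(hp j).coprime_iff_not_dvd]
      intro h
      exact hA j (Int.natCast_dvd.2 h)
  have hcop : Nat.Coprime N (∏ j, p j) := Nat.Coprime.prod_right fun j _ => (hpN j).symm
  obtain ⟨y, hy1, hy2⟩ := Nat.chineseRemainder hcop r x
  have hM0 : N * ∏ j, p j ≠ 0 := mul_ne_zero hN0 (Finset.prod_ne_zero_iff.2 fun j _ => (hp j).ne_zero)
  have hyj : ∀ j, y ≡ c j [MOD p j] := fun j =>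
    (hy2.of_dvd (Finset.dvd_prod_of_mem p (Finset.mem_univ j))).trans (hx j (Finset.mem_univ j))
  have hyc : y.Coprime (N * ∏ j, p j) := by
    refine Nat.Coprime.mul_right ?_ (Nat.Coprime.prod_right fun j _ => ?_)
    · rw [Nat.Coprime, hy1.gcd_eq]; exact hcopr
    · rw [Nat.coprime_comm, (hp j).coprime_iff_not_dvd]
      intro h
      exact hc j (((hyj j).dvd_iff dvd_rfl).1 h)
  obtain ⟨ℓ, hgt, hl, hmod⟩ := Nat.forall_exists_prime_gt_and_modEq (2 + ∏ j, p j) hM0 hyc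
  refine ⟨ℓ, hl, ?_, fun j => ?_⟩
  · apply ZMod.nonsquare_of_jacobiSym_eq_neg_one
    have hlodd : Odd ℓ := hl.odd_of_ne_two (by omega)
    have h1 : J(A | ℓ) = -1 := by
      rw [jacobiSym.mod_right A hlodd, ← hJ, jacobiSym.mod_right A hr]
      congr 1
      exact (hmod.of_dvd (Dvd.intro _ rfl)).trans hy1
    rw [jacobiSym.mul_left, h1, jacobiSym.sq_one']
    · simp
    · rw [Int.gcd_eq_natAbs, Int.natAbs_natCast, ← Nat.coprime_iff_gcd_eq_one, Nat.coprime_comm, hl.coprime_iff_not_dvd]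
      intro h
      have h2 : ((∏ j, (p j : ℤ))).natAbs = ∏ j, p j := by
        rw [← Nat.cast_prod]; rfl
      rw [h2] at h
      have := Nat.le_of_dvd (Finset.prod_pos fun j _ => (hp j).pos) h
      omega
  · rw [ZMod.natCast_eq_natCast_iff]
    exact (hmod.of_dvd ((Finset.dvd_prod_of_mem p (Finset.mem_univ j)).mul_left _)).trans (hyj j)

open NumberTheorySymbols in
lemma case_one {K : Type} [Field K] [NumberField K] (h3 : Module.finrank ℚ K = 3)
    {n : ℕ} (p : Fin n → ℕ) (hp : ∀ j, (p j).Prime)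
    (hinj : Function.Injective p) (hp12 : ∀ j, p j % 12 = 1) (A : ℤ) (hA : ∀ j, ¬ (p j : ℤ) ∣ A)
    (hD : NumberField.discr K = A * (∏ j, (p j : ℤ)) ^ 2)
    (r : ℕ) (hr : Odd r) (hJ : J(A | r) = -1) :
    3 ^ n ≤ NumberField.classNumber K := by
  classical
  have hram : ∀ j, ∃ P : Ideal (𝓞 K), P ^ 3 = Ideal.span {(p j : 𝓞 K)} ∧ Ideal.absNorm P = p j := by
    intro j
    refine totally_ramified h3 (hp j) ?_ ?_
    · have := (hp j).two_le; have := hp12 j; omega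
    · rw [hD]
      exact (pow_dvd_pow_of_dvd (Finset.dvd_prod_of_mem (fun j => (p j : ℤ)) (Finset.mem_univ j)) 2).mul_left _
  choose P hP hPN using hram
  choose g hg0 hg using fun j => exists_cubic_nonresidue (hp j) (hp12 j)
  have hex : ∀ v : Fin n → Fin 3, ∃ I : nonZeroDivisors (Ideal (𝓞 K)),
      ∀ j, ((Ideal.absNorm (I : Ideal (𝓞 K)) : ℕ) : ZMod (p j)) = (g j : ZMod (p j)) ^ (v j : ℕ) := by
    intro v
    obtain ⟨ℓ, hl, hsq, hlc⟩ := exists_prime_aux p (fun j => g j ^ (v j : ℕ)) hp hinj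
      (fun j h => by have := hp12 j; omega) A hA
      (fun j h => hg0 j ((ZMod.natCast_eq_zero_iff _ _).2 ((hp j).dvd_of_dvd_pow h))) r hr hJ
    rw [← hD] at hsq
    obtain ⟨I, hI⟩ := exists_ideal_norm_eq h3 hl hsq
    have hI0 : I ≠ 0 := by
      rintro rfl
      rw [Ideal.zero_eq_bot, Ideal.absNorm_bot] at hI
      exact hl.ne_zero hI.symm
    refine ⟨⟨I, mem_nonZeroDivisors_of_ne_zero hI0⟩, fun j => ?_⟩
    simp only [hI]
    rw [hlc j]; push_cast; rfl
  choose I hI using hex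
  have hinj2 : Function.Injective fun v => ClassGroup.mk0 (I v) := by
    intro v w hvw
    funext j
    have : Fact (p j).Prime := ⟨hp j⟩
    have h1 := class_eq_aux h3 (hp j) (hp12 j) (P j) (hP j) (hPN j) (I v) (I w) _ _ rfl rfl
      (by rw [hI]; exact pow_ne_zero _ (hg0 j)) (by rw [hI]; exact pow_ne_zero _ (hg0 j)) hvw
    rw [hI, hI] at h1
    exact cubic_exp_aux (hp j) (hp12 j) _ (hg0 j) (hg j) _ _ h1
  have := Fintype.card_le_of_injective _ hinj2
  rw [Fintype.card_fun, Fintype.card_fin, Fintype.card_fin] at this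
  exact this

open NumberTheorySymbols in
lemma exists_r_neg (A : ℤ) (hA : A < 0) : ∃ r : ℕ, Odd r ∧ J(A | r) = -1 := by
  obtain ⟨N, hN⟩ : ∃ N : ℕ, A = -(N : ℤ) := ⟨A.natAbs, by omega⟩
  have hNpos : 0 < N := by omega
  have hodd : Odd (4 * N - 1) := by rw [Nat.odd_iff]; omega
  refine ⟨4 * N - 1, hodd, ?_⟩
  rw [hN, jacobiSym.neg _ hodd, ZMod.χ₄_nat_three_mod_four (by omega)]
  have h1 : J((4 * N : ℤ) | 4 * N - 1) = 1 := by
    have h2 : (4 * N : ℤ) % ((4 * N - 1 : ℕ) : ℤ) = 1 % ((4 * N - 1 : ℕ) : ℤ) := by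
      refine Int.ModEq.symm ((Int.modEq_iff_dvd).2 ⟨1, ?_⟩)
      rw [Nat.cast_sub (by omega)]; push_cast; ring
    rw [jacobiSym.mod_left, h2, ← jacobiSym.mod_left, jacobiSym.one_left]
  have h4 : J((4 : ℤ) | 4 * N - 1) = 1 := by
    have h5 : (4 : ℤ) = 2 ^ 2 := by norm_num
    rw [h5, jacobiSym.sq_one']
    have := Nat.coprime_two_left.2 hodd
    rw [Int.gcd_eq_natAbs, Int.natAbs_natCast]
    exact this
  rw [jacobiSym.mul_left, h4, one_mul] at h1
  rw [h1]; norm_num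

open NumberTheorySymbols in
lemma exists_r_q (q : ℕ) (hq : q.Prime) (hq4 : q % 4 = 1) (B : ℤ)
    (hqB : ¬ (q : ℤ) ∣ B) : ∃ r : ℕ, Odd r ∧ J((q : ℤ) * B | r) = -1 := by
  have : Fact q.Prime := ⟨hq⟩
  have hq2 : q ≠ 2 := by omega
  obtain ⟨x, hx⟩ := FiniteField.exists_nonsquare (F := ZMod q) (by rw [ZMod.ringChar_zmod_n]; exact hq2)
  have hcop : Nat.Coprime (4 * B.natAbs) q := by
    rw [Nat.coprime_comm]
    refine Nat.Coprime.mul_right ?_ ?_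
    · exact (Nat.Coprime.pow_right 2 ((Nat.coprime_primes hq Nat.prime_two).2 hq2) :
        Nat.Coprime q (2 ^ 2))
    · rw [hq.coprime_iff_not_dvd]
      intro h
      exact hqB (Int.natCast_dvd.2 h)
  obtain ⟨r, hr1, hr2⟩ := Nat.chineseRemainder hcop 1 x.val
  have hodd : Odd r := by
    have : r ≡ 1 [MOD 2] := hr1.of_dvd (Dvd.dvd.mul_right (by norm_num) _)
    exact Nat.odd_iff.2 this
  refine ⟨r, hodd, ?_⟩
  have h1 : J(B | r) = 1 := by
    rw [jacobiSym.mod_right B hodd, hr1, ← jacobiSym.mod_right B odd_one, jacobiSym.one_right]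
  rw [jacobiSym.mul_left, h1, mul_one, jacobiSym.quadratic_reciprocity_one_mod_four hq4 hodd,
    ← jacobiSym.legendreSym.to_jacobiSym, legendreSym.eq_neg_one_iff]
  rw [Int.cast_natCast, (ZMod.natCast_eq_natCast_iff _ _ _).2 hr2, ZMod.natCast_zmod_val]
  exact hx

/-- Units modulo cubes. -/
lemma unit_exponents {K : Type} [Field K] [NumberField K] (h3 : Module.finrank ℚ K = 3) :
    ∃ f : (𝓞 K)ˣ → (Fin (NumberField.Units.rank K) → ZMod 3),
      ∀ u u', f u = f u' → ∃ w : (𝓞 K)ˣ, u = u' * w ^ 3 := by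
  have h := fun u => (NumberField.Units.exist_unique_eq_mul_prod K u).exists
  choose ζe hζe using h
  refine ⟨fun u i => ((ζe u).2 i : ZMod 3), fun u u' huu => ?_⟩
  have hd : ∀ i, ∃ d : ℤ, (ζe u).2 i = (ζe u').2 i + 3 * d := by
    intro i
    have h1 := congrFun huu i
    have h2 := (ZMod.intCast_eq_intCast_iff_dvd_sub _ _ 3).1 h1.symm
    obtain ⟨d, hd⟩ := h2
    exact ⟨d, by push_cast at hd; omega⟩
  choose d hd using hd
  have hodd : Odd (Module.finrank ℚ K) := by rw [h3]; decide
  have hz : ∀ z : NumberField.Units.torsion K, ((z : (𝓞 K)ˣ)) ^ 2 = 1 := by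
    intro z
    rcases NumberField.Units.torsion_eq_one_or_neg_one_of_odd_finrank hodd z with h | h <;> simp [h]
  set a : (𝓞 K)ˣ := ((ζe u).1 : (𝓞 K)ˣ) with ha
  set b : (𝓞 K)ˣ := ((ζe u').1 : (𝓞 K)ˣ) with hb
  have ha2 : a ^ 2 = 1 := hz _
  have hb2 : b ^ 2 = 1 := hz _
  refine ⟨a * b * ∏ i, NumberField.Units.fundSystem K i ^ d i, ?_⟩
  rw [hζe u, hζe u', ← ha, ← hb]
  have h5 : ∏ i, NumberField.Units.fundSystem K i ^ (ζe u).2 i =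
      (∏ i, NumberField.Units.fundSystem K i ^ (ζe u').2 i) *
      (∏ i, NumberField.Units.fundSystem K i ^ d i) ^ 3 := by
    rw [← Finset.prod_pow, ← Finset.prod_mul_distrib]
    refine Finset.prod_congr rfl fun i _ => ?_
    rw [hd i, zpow_add, mul_comm 3 (d i), zpow_mul]
    rfl
  rw [h5]
  have h6 : a = b * (a * b) ^ 3 := by
    calc a = a * a ^ 2 * (b ^ 2) ^ 2 := by rw [ha2, hb2]; simp
      _ = b * (a * b) ^ 3 := by
        rw [mul_pow, ← pow_succ', ← pow_mul, mul_left_comm, ← pow_succ']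
  conv_lhs => rw [h6]
  rw [mul_pow (a * b)]
  simp only [mul_assoc, mul_left_comm]

lemma places_aux {K : Type} [Field K] [NumberField K] (h3 : Module.finrank ℚ K = 3)
    (hD : 0 < NumberField.discr K) :
    InfinitePlace.nrComplexPlaces K = 0 ∧ NumberField.Units.rank K = 2 := by
  have h1 := InfinitePlace.card_add_two_mul_card_eq_rank K
  rw [h3] at h1
  have h2 := NumberField.sign_discr K
  rw [Int.sign_eq_one_of_pos hD] at h2
  have h0 : InfinitePlace.nrComplexPlaces K = 0 := by
    have : InfinitePlace.nrComplexPlaces K < 2 := by omega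
    interval_cases h : InfinitePlace.nrComplexPlaces K
    · rfl
    · simp at h2
  refine ⟨h0, ?_⟩
  unfold NumberField.Units.rank
  have := InfinitePlace.card_eq_nrRealPlaces_add_nrComplexPlaces K
  omega

lemma cube_rational {K : Type} [Field K] [NumberField K] (h3 : Module.finrank ℚ K = 3)
    (hc : InfinitePlace.nrComplexPlaces K = 0) (z : K) (ρ : ℚ) (hz : z ^ 3 = algebraMap ℚ K ρ) :
    ∃ t : ℚ, t ^ 3 = ρ := by
  have htr : IsTotallyReal K := nrComplexPlaces_eq_zero_iff.1 hc
  have hreal : ∀ φ : K →+* ℂ, ∃ c : ℝ, φ z = c ∧ c ^ 3 = ρ := by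
    intro φ
    have h1 : ComplexEmbedding.IsReal φ := by
      have := htr.isReal (InfinitePlace.mk φ)
      rwa [InfinitePlace.isReal_mk_iff] at this
    refine ⟨h1.embedding z, (h1.coe_embedding_apply z).symm, ?_⟩
    rw [← map_pow, hz]
    simp
  obtain ⟨φ₀⟩ : Nonempty (K →+* ℂ) := inferInstance
  obtain ⟨c, hc1, hc2⟩ := hreal φ₀
  have hall : ∀ φ : K →+* ℂ, φ z = c := by
    intro φ
    obtain ⟨c', h1, h2⟩ := hreal φ
    rw [h1]
    have : c' = c := (Odd.strictMono_pow (R := ℝ) (n := 3) (by decide)).injective (h2.trans hc2.symm)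
    rw [this]
  have htrace := trace_eq_sum_embeddings (K := ℚ) (L := K) ℂ (x := z)
  have h5 : ∑ σ : K →ₐ[ℚ] ℂ, σ z = 3 * (c : ℂ) := by
    rw [Finset.sum_congr rfl (fun σ _ => (hall σ.toRingHom : σ z = (c : ℂ)))]
    rw [Finset.sum_const, Finset.card_univ, AlgHom.card, h3]
    simp
  rw [h5] at htrace
  refine ⟨Algebra.trace ℚ K z / 3, ?_⟩
  have h6 : ((Algebra.trace ℚ K z : ℚ) : ℂ) = 3 * (c : ℂ) := by
    rw [← htrace]; simp
  have h7 : (Algebra.trace ℚ K z : ℝ) = 3 * c := by exact_mod_cast h6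
  have h8 : (((Algebra.trace ℚ K z / 3) ^ 3 : ℚ) : ℝ) = (ρ : ℝ) := by
    push_cast
    rw [h7, ← hc2]; ring
  exact_mod_cast h8

lemma pow_prod_val {ι : Type} [Fintype ι] (p : ι → ℕ) (hp : ∀ j, (p j).Prime)
    (hinj : Function.Injective p) (e : ι → Fin 3) (j : ι) :
    padicValRat (p j) (((∏ l, p l ^ (e l : ℕ) : ℕ)) : ℚ) = (e j : ℕ) := by
  have : Fact (p j).Prime := ⟨hp j⟩
  rw [padicValRat.of_nat]
  norm_cast
  have h0 : ∀ l ∈ Finset.univ, p l ^ (e l : ℕ) ≠ 0 := fun l _ => pow_ne_zero _ (hp l).ne_zero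
  rw [← Nat.factorization_def _ (hp j), Nat.factorization_prod h0, Finset.sum_apply']
  rw [Finset.sum_eq_single j]
  · rw [Nat.Prime.factorization_pow (hp j)]; simp
  · intro l _ hl
    rw [Nat.Prime.factorization_pow (hp l), Finsupp.single_apply, if_neg]
    exact fun h => hl (hinj h)
  · simp

lemma exps_eq {ι : Type} [Fintype ι] (p : ι → ℕ) (hp : ∀ j, (p j).Prime)
    (hinj : Function.Injective p) (e e' : ι → Fin 3) (t : ℚ)
    (ht : t ^ 3 * ((∏ l, p l ^ (e' l : ℕ) : ℕ) : ℚ) = ((∏ l, p l ^ (e l : ℕ) : ℕ) : ℚ)) :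
    e = e' := by
  have hne : ∀ e : ι → Fin 3, ((∏ l, p l ^ (e l : ℕ) : ℕ) : ℚ) ≠ 0 := by
    intro e
    exact_mod_cast Finset.prod_ne_zero_iff.2 fun l _ => pow_ne_zero _ (hp l).ne_zero
  have ht0 : t ≠ 0 := by
    rintro rfl
    apply hne e
    rw [← ht]; simp
  funext j
  have : Fact (p j).Prime := ⟨hp j⟩
  have h := congrArg (padicValRat (p j)) ht
  rw [padicValRat.mul (pow_ne_zero _ ht0) (hne e'), padicValRat.pow,
    pow_prod_val p hp hinj, pow_prod_val p hp hinj] at h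
  have h1 := (e j).2
  have h2 := (e' j).2
  apply Fin.ext
  push_cast at h
  omega

lemma case_two {K : Type} [Field K] [NumberField K] (h3 : Module.finrank ℚ K = 3)
    (hD : 0 < NumberField.discr K) {ι : Type} [Fintype ι]
    (p : ι → ℕ) (hp : ∀ j, (p j).Prime) (hinj : Function.Injective p)
    (P : ι → Ideal (𝓞 K)) (hP : ∀ j, P j ^ 3 = Ideal.span {(p j : 𝓞 K)}) :
    3 ^ Fintype.card ι ≤ 9 * NumberField.classNumber K := by
  classical
  obtain ⟨hc, hrk⟩ := places_aux h3 hD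
  obtain ⟨f, hf⟩ := unit_exponents h3
  have hP0 : ∀ j, P j ≠ ⊥ := by
    intro j h
    have h1 := hP j
    rw [h, ← Ideal.zero_eq_bot, zero_pow (by norm_num), eq_comm, Ideal.zero_eq_bot,
      Ideal.span_singleton_eq_bot] at h1
    exact (hp j).ne_zero (by exact_mod_cast h1)
  let M : (ι → Fin 3) → ℕ := fun e => ∏ l, p l ^ (e l : ℕ)
  have hM0 : ∀ e, (M e : 𝓞 K) ≠ 0 := by
    intro e
    exact_mod_cast Finset.prod_ne_zero_iff.2 fun l _ => pow_ne_zero _ (hp l).ne_zero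
  let I : (ι → Fin 3) → Ideal (𝓞 K) := fun e => ∏ l, P l ^ (e l : ℕ)
  have hI0 : ∀ e, I e ≠ 0 := fun e =>
    Finset.prod_ne_zero_iff.2 fun l _ => pow_ne_zero _ (hP0 l)
  have hI3 : ∀ e, I e ^ 3 = Ideal.span {(M e : 𝓞 K)} := by
    intro e
    simp only [I, M]
    rw [← Finset.prod_pow, Nat.cast_prod, ← Ideal.prod_span_singleton]
    refine Finset.prod_congr rfl fun l _ => ?_
    rw [← pow_mul, mul_comm, pow_mul, hP, Ideal.span_singleton_pow, Nat.cast_pow]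
  let Φ : (ι → Fin 3) → ClassGroup (𝓞 K) := fun e =>
    ClassGroup.mk0 ⟨I e, mem_nonZeroDivisors_of_ne_zero (hI0 e)⟩
  have hfib : ∀ c ∈ (Finset.univ : Finset (ClassGroup (𝓞 K))),
      (Finset.univ.filter fun e => Φ e = c).card ≤ 9 := by
    intro c _
    rcases (Finset.univ.filter fun e => Φ e = c).eq_empty_or_nonempty with h | ⟨e0, he0⟩
    · rw [h]; simp
    have he0' : Φ e0 = c := by simpa using he0
    have hex : ∀ e, Φ e = c → ∃ x y : 𝓞 K, ∃ u : (𝓞 K)ˣ, x ≠ 0 ∧ y ≠ 0 ∧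
        x ^ 3 * (M e : 𝓞 K) * u = y ^ 3 * (M e0 : 𝓞 K) := by
      intro e he
      have h1 : Φ e = Φ e0 := he.trans he0'.symm
      obtain ⟨x, y, hx, hy, hxy⟩ := (ClassGroup.mk0_eq_mk0_iff).1 h1
      have h2 := congrArg (· ^ 3) hxy
      simp only [mul_pow, hI3, Ideal.span_singleton_pow, Ideal.span_singleton_mul_span_singleton] at h2
      obtain ⟨u, hu⟩ := Ideal.span_singleton_eq_span_singleton.1 h2
      exact ⟨x, y, u, hx, hy, hu⟩
    choose! X Y U hX hY hU using hex
    have hcard : Fintype.card (Fin (NumberField.Units.rank K) → ZMod 3) = 9 := by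
      simp [ZMod.card, hrk]
    rw [← hcard, ← Finset.card_univ]
    refine Finset.card_le_card_of_injOn (fun e => f (U e)) (fun _ _ => Finset.mem_coe.2 (Finset.mem_univ _)) ?_
    intro e he e' he' hee
    have he : Φ e = c := by simpa using he
    have he' : Φ e' = c := by simpa using he'
    obtain ⟨w, hw⟩ := hf _ _ hee
    have g1 := hU e he
    have g2 := hU e' he'
    have hx := hX e he
    have hx' := hX e' he'
    have hy := hY e he
    have hy' := hY e' he'
    have hwU : ((U e : (𝓞 K)ˣ) : 𝓞 K) = (U e' : 𝓞 K) * (w : 𝓞 K) ^ 3 := by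
      rw [hw]; simp
    rw [hwU] at g1
    have hkey : (X e * Y e' * w) ^ 3 * (M e : 𝓞 K) = (X e' * Y e) ^ 3 * (M e' : 𝓞 K) := by
      have hu0 : ((U e' : (𝓞 K)ˣ) : 𝓞 K) ≠ 0 := (U e').ne_zero
      apply mul_right_cancel₀ (mul_ne_zero hu0 (hM0 e0))
      linear_combination (Y e' ^ 3 * (M e0 : 𝓞 K)) * g1 - (Y e ^ 3 * (M e0 : 𝓞 K)) * g2
    have hkeyK := congrArg (algebraMap (𝓞 K) K) hkey
    simp only [map_mul, map_pow, map_natCast] at hkeyK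
    have n1 : algebraMap (𝓞 K) K (X e) ≠ 0 := by simpa using hx
    have n2 : algebraMap (𝓞 K) K (Y e') ≠ 0 := by simpa using hy'
    have n3 : algebraMap (𝓞 K) K (w : 𝓞 K) ≠ 0 := by simp
    have n4 : algebraMap (𝓞 K) K (X e') ≠ 0 := by simpa using hx'
    have n5 : algebraMap (𝓞 K) K (Y e) ≠ 0 := by simpa using hy
    have hMQ : ∀ e, (M e : ℚ) ≠ 0 := by
      intro e
      exact_mod_cast Finset.prod_ne_zero_iff.2 fun l _ => pow_ne_zero _ (hp l).ne_zero
    have hMK : ∀ e, (M e : K) ≠ 0 := fun e => by exact_mod_cast hMQ e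
    obtain ⟨t, ht⟩ := cube_rational h3 hc
      ((algebraMap (𝓞 K) K (X e') * algebraMap (𝓞 K) K (Y e)) /
        (algebraMap (𝓞 K) K (X e) * algebraMap (𝓞 K) K (Y e') * algebraMap (𝓞 K) K (w : 𝓞 K)))
      ((M e : ℚ) / (M e' : ℚ)) (by
        rw [map_div₀, map_natCast, map_natCast, div_pow, div_eq_div_iff (by positivity) (hMK e')]
        rw [← hkeyK]; ring)
    refine exps_eq p hp hinj e e' t ?_
    change t ^ 3 * (M e' : ℚ) = (M e : ℚ)
    rw [ht, div_mul_cancel₀ _ (hMQ e')]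
  have hmain := Finset.card_le_mul_card_image_of_maps_to
    (s := (Finset.univ : Finset (ι → Fin 3))) (t := Finset.univ) (f := Φ)
    (fun _ _ => Finset.mem_univ _) 9 hfib
  simp only [Finset.card_univ, Fintype.card_fun, Fintype.card_fin] at hmain
  exact hmain


lemma exponent_bound (H : ℕ) (hH : 0 < H) : H < 3 ^ (⌈Real.log H / Real.log 3⌉₊ + 1) := by
  have h3 : 0 < Real.log 3 := Real.log_pos (by norm_num)
  have h1 : Real.log H / Real.log 3 ≤ (⌈Real.log H / Real.log 3⌉₊ : ℝ) := Nat.le_ceil _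
  rw [div_le_iff₀ h3, ← Real.log_pow] at h1
  have h2 := (Real.log_le_log_iff (by exact_mod_cast hH) (by positivity)).1 h1
  have h4 : H ≤ 3 ^ ⌈Real.log H / Real.log 3⌉₊ := by exact_mod_cast h2
  rw [pow_succ]
  omega

/-- Proposition 2.4: in Setting (S), any cubic field with `Δ_K ≡ a + i (mod m)` has
class number greater than `H`. -/
theorem classNumber_gt_of_setting_S
    (ε : ℝ) (hε : 0 < ε) (k H : ℕ) (hk : 0 < k) (hH : 0 < H)
    (n : ℕ) (hn : n = ⌈Real.log H / Real.log 3⌉₊ + 2)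
    (p : Fin k → Fin n → ℕ) (q : Fin k → ℕ)
    (hp : ∀ i j, (p i j).Prime) (hq : ∀ i, (q i).Prime)
    (hpinj : Function.Injective fun x : Fin k × Fin n => p x.1 x.2)
    (hqinj : Function.Injective q)
    (hpq : ∀ i j i', p i j ≠ q i')
    (hpk : ∀ i j, k ≤ p i j) (hp12 : ∀ i j, p i j % 12 = 1)
    (hqk : ∀ i, max k (⌊1 / ε⌋₊ + 1) < q i) (hq4 : ∀ i, q i % 4 = 1)
    (m : ℤ) (hm : m = (∏ i, (q i : ℤ)) * ∏ i, ∏ j, (p i j : ℤ) ^ 3)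
    (a : ℤ) (ha0 : 0 ≤ a) (ham : a < m)
    (ha : ∀ i : Fin k, a ≡ (q i : ℤ) * (∏ j, (p i j : ℤ) ^ 2) - ((i : ℕ) + 1)
      [ZMOD (q i : ℤ) * ∏ j, (p i j : ℤ) ^ 3]) :
    ∀ i : Fin k, ∀ (K : Type) [Field K] [NumberField K],
      Module.finrank ℚ K = 3 →
      NumberField.discr K ≡ a + ((i : ℕ) + 1) [ZMOD m] →
      H < NumberField.classNumber K := by
  intro i K _ _ h3 hdisc
  have hqdvd : (q i : ℤ) * ∏ j, (p i j : ℤ) ^ 3 ∣ m := by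
    rw [hm]
    exact mul_dvd_mul (Finset.dvd_prod_of_mem _ (Finset.mem_univ i))
      (Finset.dvd_prod_of_mem (fun i => ∏ j, (p i j : ℤ) ^ 3) (Finset.mem_univ i))
  have h1 : NumberField.discr K ≡ (q i : ℤ) * (∏ j, (p i j : ℤ) ^ 2)
      [ZMOD (q i : ℤ) * ∏ j, (p i j : ℤ) ^ 3] := by
    have h2 := (hdisc.of_dvd hqdvd).trans ((ha i).add_right ((i : ℕ) + 1 : ℤ))
    rwa [sub_add_cancel] at h2
  obtain ⟨t, ht⟩ := (Int.modEq_iff_dvd).1 h1.symm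
  set W : ℤ := ∏ j, (p i j : ℤ) with hW
  rw [Finset.prod_pow, Finset.prod_pow, ← hW] at ht
  have hD : NumberField.discr K = ((q i : ℤ) * (1 + t * W)) * W ^ 2 := by
    linear_combination ht
  have hinj : Function.Injective (p i) := fun j j' h =>
    (Prod.ext_iff.1 (@hpinj (i, j) (i, j') h)).2
  have hpdvd : ∀ j, (p i j : ℤ) ∣ W := fun j => Finset.dvd_prod_of_mem _ (Finset.mem_univ j)
  have hA : ∀ j, ¬ (p i j : ℤ) ∣ (q i : ℤ) * (1 + t * W) := by
    intro j h
    have hpr : Prime (p i j : ℤ) := Nat.prime_iff_prime_int.1 (hp i j)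
    rcases hpr.dvd_or_dvd h with h | h
    · exact hpq i j i ((Nat.prime_dvd_prime_iff_eq (hp i j) (hq i)).1 (by exact_mod_cast h))
    · have h1' := (dvd_add_left (Dvd.dvd.mul_left (hpdvd j) t)).1 h
      exact hpr.not_unit (isUnit_of_dvd_one h1')
  have hbound : H < 3 ^ (n - 1) := by
    have := exponent_bound H hH
    rw [hn]
    exact this
  have hn2 : 2 ≤ n := by omega
  refine lt_of_lt_of_le hbound ?_
  have hone : ∀ r : ℕ, Odd r → jacobiSym ((q i : ℤ) * (1 + t * W)) r = -1 →
      3 ^ (n - 1) ≤ NumberField.classNumber K := fun r hr hJ =>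
    (Nat.pow_le_pow_right (by norm_num) (Nat.sub_le n 1)).trans
      (case_one h3 (p i) (hp i) hinj (hp12 i) _ hA hD r hr hJ)
  by_cases hqB : (q i : ℤ) ∣ 1 + t * W
  swap
  · obtain ⟨r, hr, hJ⟩ := exists_r_q (q i) (hq i) (hq4 i) _ hqB
    exact hone r hr hJ
  by_cases hneg : (q i : ℤ) * (1 + t * W) < 0
  · obtain ⟨r, hr, hJ⟩ := exists_r_neg _ hneg
    exact hone r hr hJ
  have hDpos : 0 < NumberField.discr K := by
    have h0 := NumberField.discr_ne_zero K
    have : 0 ≤ NumberField.discr K := by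
      rw [hD]
      exact mul_nonneg (not_lt.1 hneg) (sq_nonneg _)
    omega
  have hp5 : ∀ j, 5 ≤ p i j := by
    intro j
    have := hp12 i j
    have := (hp i j).two_le
    omega
  have hq5 : 5 ≤ q i := by
    have := hq4 i
    have := (hq i).two_le
    omega
  let p' : Option (Fin n) → ℕ := fun o => o.elim (q i) (p i)
  have hp' : ∀ o, (p' o).Prime := by
    rintro (_ | j)
    · exact hq i
    · exact hp i j
  have hinj' : Function.Injective p' := by
    rintro (_ | j) (_ | j') h
    · rfl
    · exact absurd h.symm (hpq i j' i)
    · exact absurd h (hpq i j i)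
    · exact congrArg some (hinj h)
  have hram : ∀ o, ∃ P : Ideal (𝓞 K), P ^ 3 = Ideal.span {(p' o : 𝓞 K)} := by
    rintro (_ | j)
    · obtain ⟨P, hP, _⟩ := totally_ramified h3 (hq i) hq5 (by
        rw [hD, pow_two]
        exact Dvd.dvd.mul_right (mul_dvd_mul_left _ hqB) _)
      exact ⟨P, hP⟩
    · obtain ⟨P, hP, _⟩ := totally_ramified h3 (hp i j) (hp5 j) (by
        rw [hD]
        exact Dvd.dvd.mul_left (pow_dvd_pow_of_dvd (hpdvd j) 2) _)
      exact ⟨P, hP⟩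
  choose P hP using hram
  have hfin := case_two h3 hDpos p' hp' hinj' P hP
  rw [Fintype.card_option, Fintype.card_fin] at hfin
  have h9 : 3 ^ (n + 1) = 9 * 3 ^ (n - 1) := by
    obtain ⟨l, rfl⟩ : ∃ l, n = l + 1 := ⟨n - 1, by omega⟩
    rw [Nat.add_sub_cancel]; ring
  rw [h9] at hfin
  omega

end
end

section
/- Let K be a cubic field and let p ≥ 5 be a prime. Then p is totally ramified in K if and only if p² divides Δ_K. -/
open NumberField IntermediateField Polynomial

noncomputable section

lemma aux_trace {K : Type*} [Field K] [NumberField K] (p : ℕ) (hp : p.Prime) (hp5 : 5 ≤ p)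
    (P Q : Ideal (𝓞 K)) (hPQ : IsCoprime P Q)
    (hP : P * Q = Ideal.map (algebraMap ℤ (𝓞 K)) (Ideal.span {(p:ℤ)}))
    (hN : Ideal.absNorm P = p ^ 2) : ¬ P ∣ differentIdeal ℤ (𝓞 K) := by
  have hpp : Prime (p : ℤ) := Nat.prime_iff_prime_int.mp hp
  set I : Ideal ℤ := Ideal.span {(p:ℤ)} with hI
  have hI0 : I ≠ ⊥ := by simpa [hI] using hp.ne_zero
  have hIp : I.IsPrime := (Ideal.span_singleton_prime hpp.ne_zero).mpr hpp
  have hIm : I.IsMaximal := hIp.isMaximal hI0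
  let _ : Field (ℤ ⧸ I) := Ideal.Quotient.field I
  let a1 : Algebra (ℤ ⧸ I) (𝓞 K ⧸ Q) := Ideal.Quotient.algebraQuotientOfLEComap (by
      rw [← Ideal.map_le_iff_le_comap, ← hP]
      exact Ideal.mul_le_right)
  let a2 : Algebra (ℤ ⧸ I) (𝓞 K ⧸ P) := Ideal.Quotient.algebraQuotientOfLEComap (by
      rw [← Ideal.map_le_iff_le_comap, ← hP]
      exact Ideal.mul_le_left)
  have : IsScalarTower ℤ (ℤ ⧸ I) (𝓞 K ⧸ Q) := .of_algebraMap_eq' rfl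
  have : Module.Finite (ℤ ⧸ I) (𝓞 K ⧸ Q) :=
    Module.Finite.of_restrictScalars_finite ℤ (ℤ ⧸ I) (𝓞 K ⧸ Q)
  have : IsScalarTower ℤ (ℤ ⧸ I) (𝓞 K ⧸ P) := .of_algebraMap_eq' rfl
  have : Module.Finite (ℤ ⧸ I) (𝓞 K ⧸ P) :=
    Module.Finite.of_restrictScalars_finite ℤ (ℤ ⧸ I) (𝓞 K ⧸ P)
  let e : (𝓞 K ⧸ I.map (algebraMap ℤ (𝓞 K))) ≃ₐ[ℤ ⧸ I] ((𝓞 K ⧸ P) × 𝓞 K ⧸ Q) :=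
    { __ := (Ideal.quotEquivOfEq hP.symm).trans (Ideal.quotientMulEquivQuotientProd P Q hPQ),
      commutes' := Quotient.ind fun _ ↦ rfl }
  have hcard : Nat.card (ℤ ⧸ I) = p := by
    have := Ideal.absNorm_span_singleton (p : ℤ)
    simpa [Ideal.absNorm_apply, Submodule.cardQuot_apply] using this
  have hfin : Module.finrank (ℤ ⧸ I) (𝓞 K ⧸ P) = 2 := by
    have h1 := Module.natCard_eq_pow_finrank (K := ℤ ⧸ I) (V := 𝓞 K ⧸ P)
    rw [hcard] at h1
    have h2 : Nat.card (𝓞 K ⧸ P) = p ^ 2 := by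
      rw [← hN, Ideal.absNorm_apply, Submodule.cardQuot_apply]
    rw [h2] at h1
    exact (Nat.pow_right_injective hp.two_le h1).symm
  obtain ⟨y, hy⟩ := Ideal.Quotient.mk_surjective (e.symm (1, 0))
  refine not_dvd_differentIdeal_of_intTrace_not_mem ℤ P Q hP y ?_ ?_
  · have := congrArg (fun z => (e z).2) hy
    simp at this
    simpa [e, Ideal.Quotient.eq_zero_iff_mem] using this
  · rw [← Ideal.Quotient.eq_zero_iff_mem, ← Algebra.trace_quotient_eq_of_isDedekindDomain,
      hy, Algebra.trace_eq_of_algEquiv, Algebra.trace_prod_apply]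
    have h1 : Algebra.trace (ℤ ⧸ I) (𝓞 K ⧸ P) 1 = 2 := by
      have := Algebra.trace_algebraMap (R := ℤ ⧸ I) (S := 𝓞 K ⧸ P) 1
      rw [map_one, hfin] at this
      simpa using this
    simp only [h1, map_zero, add_zero]
    have : (2 : ℤ ⧸ I) = Ideal.Quotient.mk I 2 := by simp
    rw [this, Ideal.Quotient.eq_zero_iff_mem, hI, Ideal.mem_span_singleton]
    intro h
    have := Int.le_of_dvd (by norm_num) h
    omega

lemma cubic_aux_main
    (K : Type*) [Field K] [NumberField K] (hK : Module.finrank ℚ K = 3)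
    (p : ℕ) (hp : p.Prime) (hp5 : 5 ≤ p) :
    (∃ 𝔭 : Ideal (𝓞 K), 𝔭.IsPrime ∧ Ideal.span {(p : 𝓞 K)} = 𝔭 ^ 3)
      ↔ (p : ℤ) ^ 2 ∣ NumberField.discr K := by
  have hpp : Prime (p : ℤ) := Nat.prime_iff_prime_int.mp hp
  have hp0 : Ideal.span {(p:ℤ)} ≠ ⊥ := by simpa using hp.ne_zero
  have hIp : (Ideal.span {(p:ℤ)}).IsPrime := (Ideal.span_singleton_prime hpp.ne_zero).mpr hpp
  have hIm : (Ideal.span {(p:ℤ)}).IsMaximal := hIp.isMaximal hp0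
  have hmap : Ideal.map (algebraMap ℤ (𝓞 K)) (Ideal.span {(p:ℤ)}) = Ideal.span {(p : 𝓞 K)} := by
    simp [Ideal.map_span]
  have hN : Ideal.absNorm (Ideal.span {(p : 𝓞 K)}) = p ^ 3 := by
    rw [Ideal.absNorm_span_natCast, RingOfIntegers.rank, hK]
  have hD := NumberField.absNorm_differentIdeal K (𝓞 K)
  have hdvd : (p : ℤ) ^ 2 ∣ NumberField.discr K ↔ p ^ 2 ∣ Ideal.absNorm (differentIdeal ℤ (𝓞 K)) := by
    rw [hD, ← Int.natCast_dvd_natCast, Int.dvd_natAbs]; simp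
  have hfin : Finite (ℤ ⧸ Ideal.span {(p:ℤ)}) := by
    have : Ideal.absNorm (Ideal.span {(p:ℤ)}) ≠ 0 := by
      simpa [Ideal.absNorm_eq_zero_iff] using hp.ne_zero
    exact (Ideal.absNorm_ne_zero_iff _).mp this
  rw [hdvd]
  constructor
  · rintro ⟨P, -, h⟩
    have h1 : Ideal.absNorm P = p := by
      have : Ideal.absNorm P ^ 3 = p ^ 3 := by rw [← map_pow, ← h, hN]
      exact Nat.pow_left_injective (n := 3) (by norm_num) this
    have h2 : P ^ (3 - 1) ∣ differentIdeal ℤ (𝓞 K) :=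
      pow_sub_one_dvd_differentIdeal ℤ P 3 hp0 (by rw [hmap, h])
    have := Ideal.absNorm_dvd_absNorm_of_le (Ideal.dvd_iff_le.mp h2)
    simpa [h1] using this
  · intro h
    have key : ∀ J : Ideal (𝓞 K), p ∣ Ideal.absNorm J → ∃ P : Ideal (𝓞 K), P.IsMaximal ∧
        P ∣ Ideal.span {(p : 𝓞 K)} ∧ P ∣ J := by
      intro J hJ
      obtain ⟨P, hP, h1, h2⟩ := Ideal.exists_isMaximal_dvd_of_dvd_absNorm hpp J
        (by exact_mod_cast hJ)
      refine ⟨P, hP, ?_, h2⟩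
      rw [Ideal.dvd_iff_le, ← hmap, Ideal.map_le_iff_le_comap]
      exact h1.ge
    have hcop : ∀ P Q : Ideal (𝓞 K), P.IsMaximal → Ideal.span {(p : 𝓞 K)} = P * Q →
        P ∣ differentIdeal ℤ (𝓞 K) → P ∣ Q := by
      intro P Q hP hPQ hPD
      by_contra hn
      refine not_dvd_differentIdeal_of_isCoprime ℤ P Q ?_ (hPQ.symm.trans hmap.symm) hPD
      rw [Ideal.isCoprime_iff_sup_eq]
      exact hP.1.2 _ (left_lt_sup.mpr fun h => hn (Ideal.dvd_iff_le.mpr h))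
    obtain ⟨P, hPm, ⟨Q₀, hQ₀⟩, hPD⟩ := key _ ((dvd_pow_self p two_ne_zero).trans h)
    obtain ⟨Q, rfl⟩ := hcop P Q₀ hPm hQ₀ hPD
    have hNP1 : Ideal.absNorm P ≠ 1 := by
      rw [Ne, Ideal.absNorm_eq_one_iff]; exact hPm.ne_top
    have hmul : Ideal.absNorm P * (Ideal.absNorm P * Ideal.absNorm Q) = p ^ 3 := by
      rw [← map_mul, ← map_mul, ← hQ₀, hN]
    obtain ⟨f, -, hf⟩ := (Nat.dvd_prime_pow hp).mp (Dvd.intro _ hmul)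
    have hf0 : f ≠ 0 := by rintro rfl; exact hNP1 (by simpa using hf)
    have hf1 : f = 1 := by
      by_contra hf1
      have h4 : p ^ 4 ∣ p ^ 3 := by
        rw [← hmul, hf]
        calc p ^ 4 ∣ p ^ (f + f) := pow_dvd_pow _ (by omega)
          _ ∣ _ := by rw [← mul_assoc, ← pow_add]; exact Dvd.intro _ rfl
      have := (Nat.pow_dvd_pow_iff_le_right hp.one_lt).mp h4
      omega
    subst hf1
    rw [pow_one] at hf
    have hNQ : Ideal.absNorm Q = p := by
      rw [hf] at hmul
      have : p * (p * Ideal.absNorm Q) = p * (p * p) := by rw [hmul]; ring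
      exact Nat.eq_of_mul_eq_mul_left hp.pos (Nat.eq_of_mul_eq_mul_left hp.pos this)
    have hQp : Q.IsPrime := Ideal.isPrime_of_irreducible_absNorm (by rw [hNQ]; exact hp)
    have hQ0 : Q ≠ ⊥ := by
      rintro rfl; simp at hNQ; exact hp.ne_zero hNQ.symm
    have hQm : Q.IsMaximal := hQp.isMaximal hQ0
    by_cases hPQ : P = Q
    · subst hPQ
      exact ⟨P, hPm.isPrime, by rw [hQ₀]; ring⟩
    exfalso
    have hPQc : IsCoprime P Q := by
      rw [Ideal.isCoprime_iff_sup_eq]; exact hPm.coprime_of_ne hQm hPQ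
    have hQD : ¬ Q ∣ differentIdeal ℤ (𝓞 K) := by
      intro hd
      have h1 := hcop Q (P * P) hQm (by rw [hQ₀]; ring) hd
      rw [Ideal.dvd_iff_le, hQp.mul_le, or_self] at h1
      exact hPQ (hPm.eq_of_le hQm.ne_top h1)
    have hPPD : ¬ P * P ∣ differentIdeal ℤ (𝓞 K) :=
      aux_trace p hp hp5 (P * P) Q (hPQc.mul_left hPQc) (by rw [hmap, hQ₀]; ring)
        (by rw [map_mul, hf]; ring)
    obtain ⟨D, hD'⟩ := hPD
    have hpD : p ∣ Ideal.absNorm D := by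
      rw [hD', map_mul, hf, sq] at h
      exact Nat.dvd_of_mul_dvd_mul_left hp.pos h
    obtain ⟨R, hRm, hRp, hRD⟩ := key D hpD
    rw [hQ₀, Ideal.dvd_iff_le, hRm.isPrime.mul_le, hRm.isPrime.mul_le] at hRp
    have : P ≤ R ∨ Q ≤ R := by tauto
    rcases this with h1 | h1
    · obtain rfl := hPm.eq_of_le hRm.ne_top h1
      exact hPPD (hD' ▸ mul_dvd_mul_left P hRD)
    · obtain rfl := hQm.eq_of_le hRm.ne_top h1
      exact hQD (hD' ▸ hRD.mul_left P)

/-- For a cubic field `K` and a prime `p ≥ 5`, `p` is totally ramified in `K`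
iff `p²` divides `Δ_K`. -/
theorem totallyRamified_iff_sq_dvd_discr
    (K : Type*) [Field K] [NumberField K] (hK : Module.finrank ℚ K = 3)
    (p : ℕ) (hp : p.Prime) (hp5 : 5 ≤ p) :
    TotallyRamified p K ↔ (p : ℤ) ^ 2 ∣ NumberField.discr K :=
  cubic_aux_main K hK p hp hp5

end
end

section
/- Let K be a cubic field and let p ≥ 5 be a prime. Then p³ does not divide Δ_K. -/
open NumberField IntermediateField Polynomial

noncomputable section

set_option maxHeartbeats 4000000 in
theorem aux_CH (A : Matrix (Fin 3) (Fin 3) ℤ) :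
    (6:ℤ) • A^3 - (6 * A.trace) • A^2 + (3 * (A.trace^2 - (A^2).trace)) • A
      - (A.trace^3 - 3 * A.trace * (A^2).trace + 2 * (A^3).trace) • (1 : Matrix (Fin 3) (Fin 3) ℤ) = 0 := by
  have h2 : A^2 = A * A := pow_two A
  have h3 : A^3 = A * A * A := by rw [pow_succ, h2]
  rw [h2, h3]
  ext i j
  fin_cases i <;> fin_cases j <;>
    simp only [Matrix.sub_apply, Matrix.add_apply, Matrix.smul_apply, smul_eq_mul, Matrix.mul_apply,
      Matrix.trace, Matrix.diag_apply, Fin.sum_univ_three, Matrix.one_apply, Matrix.zero_apply,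
      Fin.zero_eta, Fin.mk_one, Fin.reduceFinMk, Fin.reduceEq, if_true, if_false, Fin.isValue,
      zero_ne_one, one_ne_zero] <;> ring

theorem aux_mat {n : Type*} [Fintype n] [DecidableEq n] (hn : Fintype.card n = 3)
    (M : Matrix n n ℤ) (p : ℕ) (hp : p.Prime) (hdet : (p:ℤ)^3 ∣ M.det) (h0 : M.det ≠ 0)
    (hM : ∃ i j, ¬ (p:ℤ) ∣ M i j) :
    ∃ v : n → ℤ, (∃ i, ¬ (p:ℤ) ∣ v i) ∧ ∀ i, (p:ℤ)^2 ∣ (M.mulVec v) i := by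
  have hpp : Prime (p:ℤ) := Nat.prime_iff_prime_int.mp hp
  obtain ⟨a, b, hab⟩ := hM
  have hadj : M.adjugate ≠ 0 := by
    intro h
    have := Matrix.mul_adjugate M
    rw [h, mul_zero] at this
    have := congrFun (congrFun this a) a
    simp at this
    exact h0 this.symm
  have hex : ∃ k, ¬ ∀ i j, (p:ℤ)^k ∣ M.adjugate i j := by
    by_contra! hcon
    apply hadj
    ext i j
    by_contra hne
    have hf : FiniteMultiplicity (p:ℤ) (M.adjugate i j) :=
      Int.finiteMultiplicity_iff.mpr ⟨by simpa using hp.ne_one, hne⟩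
    obtain ⟨m, hm⟩ := hf
    exact hm (hcon _ i j)
  classical
  obtain ⟨k, hk⟩ : ∃ k, Nat.find hex = k + 1 := by
    refine Nat.exists_eq_succ_of_ne_zero ?_
    intro h
    have := Nat.find_spec hex
    rw [h] at this
    simp at this
  have hk1 : ¬ ∀ i j, (p:ℤ)^(k+1) ∣ M.adjugate i j := hk ▸ Nat.find_spec hex
  have hk0 : ∀ i j, (p:ℤ)^k ∣ M.adjugate i j := by
    have := Nat.find_min hex (m := k) (by omega)
    push Not at this
    exact this
  choose N hN using hk0
  have hadjN : M.adjugate = (p:ℤ)^k • Matrix.of N := by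
    ext i j; simpa using hN i j
  have hd : (p:ℤ)^(k+2) ∣ M.det := by
    rcases Nat.lt_or_ge k 2 with h | h
    · exact (pow_dvd_pow _ (by omega)).trans hdet
    · have h2 : M.adjugate.adjugate = M.det • M := by
        rw [Matrix.adjugate_adjugate _ (by omega), hn]; simp
      rw [hadjN, Matrix.adjugate_smul, hn] at h2
      have h3 : (p:ℤ)^(2*k) ∣ M.det * M a b := by
        have := congrFun (congrFun h2 a) b
        simp only [Matrix.smul_apply, smul_eq_mul] at this
        rw [← this, ← pow_mul]
        exact Dvd.dvd.mul_right (pow_dvd_pow _ (by omega)) _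
      have h4 : (p:ℤ)^(2*k) ∣ M.det := hpp.pow_dvd_of_dvd_mul_right _ hab h3
      exact (pow_dvd_pow _ (by omega)).trans h4
  push Not at hk1
  obtain ⟨i0, j0, hij⟩ := hk1
  obtain ⟨c, hc⟩ := hd
  refine ⟨fun i => N i j0, ⟨i0, ?_⟩, ?_⟩
  · rintro ⟨d, hd⟩
    apply hij
    have hd' : N i0 j0 = p * d := hd
    rw [hN, hd']
    exact ⟨d, by ring⟩
  · intro i
    have h5 := congrFun (congrFun (Matrix.mul_adjugate M) i) j0
    rw [hadjN, hc] at h5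
    have h6 : (p:ℤ)^k * (M.mulVec (fun i => N i j0)) i
        = (p:ℤ)^k * ((p:ℤ)^2 * (c * (1 : Matrix n n ℤ) i j0)) := by
      rw [Matrix.mul_smul] at h5
      simp only [Matrix.smul_apply, smul_eq_mul, Matrix.mul_apply, Matrix.of_apply] at h5
      simp only [Matrix.mulVec, dotProduct]
      rw [h5]; ring
    exact ⟨_, mul_left_cancel₀ (pow_ne_zero _ hpp.ne_zero) h6⟩

theorem aux_CHB {B : Type*} [CommRing B] (b : Module.Basis (Fin 3) ℤ B) (y : B) :
    (6:ℤ) • y^3 - (6 * Algebra.trace ℤ B y) • y^2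
      + (3 * ((Algebra.trace ℤ B y)^2 - Algebra.trace ℤ B (y^2))) • y
      - ((Algebra.trace ℤ B y)^3 - 3 * Algebra.trace ℤ B y * Algebra.trace ℤ B (y^2)
        + 2 * Algebra.trace ℤ B (y^3)) • (1 : B) = 0 := by
  apply Algebra.leftMulMatrix_injective b
  simp only [Algebra.trace_eq_matrix_trace b, map_sub, map_add, map_smul, map_pow, map_one, map_zero]
  exact aux_CH _

theorem aux_cop {B : Type*} [CommRing B] (p : ℕ) (hp : p.Prime) (hp5 : 5 ≤ p) (k : ℕ) (x : B)
    (h : (p:B)^k ∣ 6 * x) : (p:B)^k ∣ x := by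
  have hc : Nat.Coprime (p^k) 6 := by
    apply Nat.Coprime.pow_left
    rw [Nat.Prime.coprime_iff_not_dvd hp]
    intro h6
    have := Nat.le_of_dvd (by norm_num) h6
    interval_cases p <;> revert hp h6 <;> decide
  have := Nat.isCoprime_iff_coprime.mpr hc
  have h2 : IsCoprime ((p:B)^k) (6:B) := by
    have := this.map (Int.castRingHom B)
    simpa using this
  exact h2.dvd_of_dvd_mul_left h

theorem aux_int (K : Type*) [Field K] [NumberField K] (p : ℕ) (hp : p ≠ 0) (Y a b c : 𝓞 K)
    (h : Y^3 + p * a * Y^2 + p^2 * b * Y + p^3 * c = 0) : (p : 𝓞 K) ∣ Y := by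
  have hp' : (p : K) ≠ 0 := by exact_mod_cast hp
  have hi : IsIntegral (𝓞 K) ((Y : K) / p) := by
    refine ⟨X^3 + (C a * X^2 + C b * X + C c), ?_, ?_⟩
    · apply monic_X_pow_add
      compute_degree!
    · have h1 : (Y:K)^3 + p * a * Y^2 + p^2 * b * Y + p^3 * c = 0 := by
        have := congrArg (algebraMap (𝓞 K) K) h
        simpa using this
      simp only [eval₂_add, eval₂_mul, eval₂_pow, eval₂_X, eval₂_C]
      field_simp
      linear_combination h1
  obtain ⟨z, hz⟩ := IsIntegrallyClosed.isIntegral_iff.mp hi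
  refine ⟨z, ?_⟩
  apply FaithfulSMul.algebraMap_injective (𝓞 K) K
  rw [map_mul, hz]
  simp
  field_simp

theorem aux_main (K : Type*) [Field K] [NumberField K] (b : Module.Basis (Fin 3) ℤ (𝓞 K))
    (p : ℕ) (hp : p.Prime) (hp5 : 5 ≤ p) (y : 𝓞 K)
    (hy : ∀ z, (p:ℤ)^2 ∣ Algebra.trace ℤ (𝓞 K) (y * z)) : (p : 𝓞 K) ∣ y := by
  have hpB : (p : 𝓞 K) ≠ 0 := by exact_mod_cast hp.ne_zero
  obtain ⟨t1, h1⟩ := hy 1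
  obtain ⟨t2, h2⟩ := hy y
  obtain ⟨t3, h3⟩ := hy (y^2)
  rw [mul_one] at h1
  rw [← pow_two] at h2
  rw [← pow_succ'] at h3
  have CH := aux_CHB b y
  rw [h1, h2] at CH
  have hy3 : (p : 𝓞 K)^2 ∣ y^3 := by
    apply aux_cop p hp hp5
    rw [h3] at CH
    simp only [zsmul_eq_mul] at CH
    push_cast at CH
    refine ⟨6 * t1 * y^2 - 3 * (p^2*t1^2 - t2) * y + (p^4*t1^3 - 3 * p^2 * t1 * t2 + 2 * t3), ?_⟩
    linear_combination CH
  obtain ⟨u, hu⟩ := hy3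
  obtain ⟨w, hw⟩ : (p : 𝓞 K) ∣ y^2 := by
    apply aux_int K p hp.ne_zero (y^2) 0 0 (-(p*u^2))
    linear_combination (y^3 + p^2*u) * hu
  obtain ⟨s, hs⟩ := hy w
  have h3' : Algebra.trace ℤ (𝓞 K) (y^3) = p^3 * s := by
    have : y^3 = (p:ℤ) • (y * w) := by
      simp only [zsmul_eq_mul]; push_cast; linear_combination y * hw
    rw [this, map_smul, hs, smul_eq_mul]; ring
  rw [h3'] at CH
  simp only [zsmul_eq_mul] at CH
  push_cast at CH
  have : (p:𝓞 K)^1 ∣ 6 * y := by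
    rw [pow_one]
    apply aux_int K p hp.ne_zero (6*y) (-(6 * p * t1)) (18 * (p^2*t1^2 - t2))
      (-36 * (p^3*t1^3 - 3 * p * t1 * t2 + 2 * s))
    linear_combination 36 * CH
  simpa using aux_cop p hp hp5 1 y this

/-- For a cubic field `K` and a prime `p ≥ 5`, `p³` does not divide `Δ_K`. -/
theorem not_pow_three_dvd_discr
    (K : Type*) [Field K] [NumberField K] (hK : Module.finrank ℚ K = 3)
    (p : ℕ) (hp : p.Prime) (hp5 : 5 ≤ p) :
    ¬ (p : ℤ) ^ 3 ∣ NumberField.discr K := by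
  intro hdvd
  classical
  have hcard : Fintype.card (Module.Free.ChooseBasisIndex ℤ (𝓞 K)) = 3 := by
    rw [← Module.finrank_eq_card_chooseBasisIndex, RingOfIntegers.rank, hK]
  let b := (RingOfIntegers.basis K).reindex (Fintype.equivFinOfCardEq hcard)
  have hd : NumberField.discr K = (Algebra.traceMatrix ℤ b).det :=
    (NumberField.discr_eq_discr K b).symm
  have hsum : ∀ z : 𝓞 K, z = ∑ i, b.repr z i • b i := fun z => (b.sum_repr z).symm
  have hM : ∃ i j, ¬ (p:ℤ) ∣ Algebra.traceMatrix ℤ b i j := by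
    by_contra! hcon
    have h3 : Algebra.trace ℤ (𝓞 K) (1 * 1) = 3 := by
      rw [mul_one]
      have := Algebra.trace_algebraMap (R := ℤ) (S := 𝓞 K) 1
      rw [RingOfIntegers.rank, hK] at this
      simpa using this
    have : (p:ℤ) ∣ 3 := by
      rw [← h3, hsum 1, Finset.sum_mul_sum, map_sum]
      refine Finset.dvd_sum fun i _ => ?_
      rw [map_sum]
      refine Finset.dvd_sum fun j _ => ?_
      rw [smul_mul_smul_comm, map_smul, smul_eq_mul]
      exact Dvd.dvd.mul_left (hcon i j) _
    have := Int.le_of_dvd (by norm_num) this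
    omega
  obtain ⟨v, ⟨i, hi⟩, hv⟩ := aux_mat (by simp) (Algebra.traceMatrix ℤ b) p hp (hd ▸ hdvd)
    (hd ▸ NumberField.discr_ne_zero K) hM
  apply hi
  obtain ⟨x, hx⟩ := aux_main K b p hp hp5 (∑ j, v j • b j) (by
    intro z
    rw [hsum z, Finset.mul_sum, map_sum]
    refine Finset.dvd_sum fun i _ => ?_
    rw [mul_smul_comm, map_smul, smul_eq_mul]
    refine Dvd.dvd.mul_left ?_ _
    refine (hv i).trans (dvd_of_eq ?_)
    symm
    rw [Finset.sum_mul, map_sum]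
    simp only [Matrix.mulVec, dotProduct, Algebra.traceMatrix_apply, Algebra.traceForm_apply]
    refine Finset.sum_congr rfl fun j _ => ?_
    rw [smul_mul_assoc, map_smul, smul_eq_mul, mul_comm, mul_comm (b j)])
  have hx' : ∑ j, v j • b j = (p:ℤ) • x := by
    rw [hx, zsmul_eq_mul]; push_cast; rfl
  have := congrArg (fun z => b.repr z i) hx'
  simp only [Module.Basis.repr_sum_self, map_smul, Finsupp.smul_apply, smul_eq_mul] at this
  exact ⟨_, this⟩

end
end
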